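/- arXiv:1409.7059 — 2 statements merged into one kernel-verified Lean document; each statement's English description precedes it below -/
import Mathlib

section
/- [Main Theorem] Let P, Q ∈ ℂ[x,y] with P(0) = Q(0) = 0, deg P = k ≥ 1, deg Q = l ≥ 1, and k·l > 1. Let s = s(P_k) and let G be a simple homogeneous polynomial with G^s = P_k. Then the Jacobian determinant D(P,Q) is a constant if and only if there exist λ_0, λ_1, …, λ_{k+l−3} ∈ ℂ, and these are unique, such that, setting for each r: s_r = s·(l−r)/k if λ_r ≠ 0 (in which case s·(l−r)/k is necessarily an integer) and s_r = 0 if λ_r = 0, one has for every j with 0 ≤ j ≤ k + l − 3, in the fraction field of ℂ[x,y]: Q_{l−j} = Σ_{r=0}^{j} Σ_{α ∈ Γ, σ(α) = j − r} λ_r · C(s_r/s, α) · G^{s_r − s|α|} · ∏_{i≥1} P_{k−i}^{α_i}, where the homogeneous components P_m, Q_m are taken to be 0 for m < 0, and integer powers of G are taken in the fraction field (G ≠ 0 since P_k ≠ 0). -/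
open MvPolynomial

/-- The fraction field of `ℂ[x,y]`. -/
abbrev FF : Type := FractionRing (MvPolynomial (Fin 2) ℂ)

/-- The Jacobian determinant `D(F,G) = F_x G_y - F_y G_x` of two polynomials in two
variables, using formal partial derivatives. -/
noncomputable def jacDet (F G : MvPolynomial (Fin 2) ℂ) : MvPolynomial (Fin 2) ℂ :=
  pderiv 0 F * pderiv 1 G - pderiv 1 F * pderiv 0 G

/-- For an element `R` of the fraction field of `ℂ[x,y]`,
`sVal R = sup {m ≥ 1 | R = X^m for some X in the fraction field}`. -/
noncomputable def sVal (R : FF) : ℕ :=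
  sSup {m : ℕ | 1 ≤ m ∧ ∃ X : FF, R = X ^ m}

/-- The homogeneous component of degree `m ∈ ℤ` of a polynomial, with the convention
that it is `0` for negative `m`. -/
noncomputable def hcomp (P : MvPolynomial (Fin 2) ℂ) (m : ℤ) : MvPolynomial (Fin 2) ℂ :=
  if 0 ≤ m then MvPolynomial.homogeneousComponent m.toNat P else 0

/-- The modulus `|α| = Σ_i α_i`. -/
def msize (a : ℕ+ →₀ ℕ) : ℕ := a.sum fun _ n => n

/-- The size `σ(α) = Σ_i i·α_i`. -/
def ssize (a : ℕ+ →₀ ℕ) : ℕ := a.sum fun i n => (i : ℕ) * n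

/-- `α! = Π_i (α_i)!`. -/
def gfact (a : ℕ+ →₀ ℕ) : ℕ := a.prod fun _ n => n.factorial

/-- The generalized multinomial coefficient `C(t, α) = (t)_{|α|} / α!`, where `(t)_m`
is the falling factorial. -/
noncomputable def mcoeff (t : ℚ) (a : ℕ+ →₀ ℕ) : ℚ :=
  Polynomial.eval t (descPochhammer ℚ (msize a)) / (gfact a : ℚ)

namespace PowerSeries

/-- A derivation of `A` acting coefficientwise on `A⟦X⟧`. -/
noncomputable def _root_.Derivation.coeffwise {R A : Type*} [CommRing R] [CommRing A] [Algebra R A]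
    (d : Derivation R A A) : Derivation R A⟦X⟧ A⟦X⟧ :=
  Derivation.mk'
    { toFun := fun f => PowerSeries.mk fun n => d (coeff n f)
      map_add' := fun f g => by ext n; simp
      map_smul' := fun c f => by ext n; simp }
    (fun f g => by
      ext n
      simp only [LinearMap.coe_mk, AddHom.coe_mk, coeff_mk, coeff_mul, map_sum, map_add,
        Derivation.leibniz, smul_eq_mul, Finset.sum_add_distrib]
      congr 1
      rw [← Finset.Nat.sum_antidiagonal_swap]
      rfl)

section Coeffwise

variable {R A : Type*} [CommRing R] [CommRing A] [Algebra R A] (d : Derivation R A A)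

@[simp]
theorem _root_.Derivation.coeff_coeffwise (f : A⟦X⟧) (n : ℕ) :
    coeff n (d.coeffwise f) = d (coeff n f) := by
  simp [Derivation.coeffwise]

@[simp]
theorem _root_.Derivation.constantCoeff_coeffwise (f : A⟦X⟧) :
    constantCoeff (d.coeffwise f) = d (constantCoeff f) := by
  rw [← coeff_zero_eq_constantCoeff_apply, ← coeff_zero_eq_constantCoeff_apply,
    d.coeff_coeffwise]

@[simp]
theorem _root_.Derivation.coeffwise_C (a : A) : d.coeffwise (C a) = C (d a) := by
  ext n
  simp only [Derivation.coeff_coeffwise, coeff_C]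
  split_ifs <;> simp

@[simp]
theorem _root_.Derivation.coeffwise_X : d.coeffwise (X : A⟦X⟧) = 0 := by
  ext n
  simp only [Derivation.coeff_coeffwise, coeff_X]
  split_ifs <;> simp

theorem _root_.Derivation.X_pow_dvd_coeffwise {f : A⟦X⟧} {n : ℕ} (h : (X : A⟦X⟧) ^ n ∣ f) :
    (X : A⟦X⟧) ^ n ∣ d.coeffwise f := by
  rw [X_pow_dvd_iff] at h ⊢
  intro m hm
  rw [Derivation.coeff_coeffwise, h m hm, map_zero]

end Coeffwise

/-- The Jacobian bracket attached to a pair of derivations. -/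
def _root_.Derivation.bracket {R A : Type*} [CommRing R] [CommRing A] [Algebra R A]
    (d₁ d₂ : Derivation R A A) (f g : A) : A :=
  d₁ f * d₂ g - d₂ f * d₁ g

/-- The coefficient of `u ^ m` in the binomial series `(1 + u) ^ t`. -/
noncomputable def binomCoeff (t : ℚ) (m : ℕ) : ℚ :=
  Polynomial.eval t (descPochhammer ℚ m) / (m.factorial : ℚ)

theorem binomCoeff_zero (t : ℚ) : binomCoeff t 0 = 1 := by simp [binomCoeff]

theorem binomCoeff_succ (t : ℚ) (m : ℕ) :
    ((m : ℚ) + 1) * binomCoeff t (m + 1) = (t - m) * binomCoeff t m := by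
  have h : (m.factorial : ℚ) ≠ 0 := by exact_mod_cast m.factorial_ne_zero
  have h' : (m : ℚ) + 1 ≠ 0 := by positivity
  simp only [binomCoeff, descPochhammer_succ_right, Nat.factorial_succ]
  push_cast
  simp
  field_simp

/-- The binomial series `(1 + u) ^ t` truncated after the term `u ^ N`. -/
noncomputable def truncBinom {A : Type*} [CommRing A] [Algebra ℚ A] (t : ℚ) (N : ℕ) (u : A) : A :=
  ∑ m ∈ Finset.range (N + 1), algebraMap ℚ A (binomCoeff t m) * u ^ m

theorem truncBinom_derivation {R A : Type*} [CommRing R] [CommRing A] [Algebra R A] [Algebra ℚ A]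
    (d : Derivation R A A) (t : ℚ) (N : ℕ) (u : A) :
    (1 + u) * d (truncBinom t N u) =
      (algebraMap ℚ A t * truncBinom t N u +
        algebraMap ℚ A ((N - t) * binomCoeff t N) * u ^ N) * d u := by
  have hd : ∀ q : ℚ, d (algebraMap ℚ A q) = 0 := fun q => by
    rw [Algebra.algebraMap_eq_smul_one, map_rat_smul, d.map_one_eq_zero, smul_zero]
  induction N with
  | zero => simp [truncBinom, binomCoeff_zero]
  | succ N ih =>
    have hs : truncBinom t (N + 1) u = truncBinom t N u +
        algebraMap ℚ A (binomCoeff t (N + 1)) * u ^ (N + 1) := Finset.sum_range_succ _ _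
    have hb := congrArg (algebraMap ℚ A) (binomCoeff_succ t N)
    rw [hs, map_add, mul_add, ih, d.leibniz, d.leibniz_pow, hd]
    simp only [map_mul, map_add, map_sub, map_natCast, map_one] at hb ⊢
    push_cast
    simp only [smul_eq_mul, nsmul_eq_mul, mul_zero, add_zero]
    push_cast
    linear_combination (u ^ N * d u) * hb

section Integration

variable {R K : Type*} [CommRing R] [Field K] [Algebra R K]

theorem _root_.Derivation.bracket_add_right {A : Type*} [CommRing A] [Algebra R A]
    (d₁ d₂ : Derivation R A A) (f g h : A) : d₁.bracket d₂ f (g + h) = d₁.bracket d₂ f g + d₁.bracket d₂ f h := by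
  simp only [Derivation.bracket, map_add]; ring

theorem existsUnique_expansion (d₁ d₂ : Derivation R K K) (N : ℕ) (p q : K⟦X⟧)
    {L : Type*} [Zero L] (T : ℕ → L → K⟦X⟧) (good : ℕ → L → Prop) (H : ℕ → AddSubgroup K)
    (good_zero : ∀ r, good r 0)
    (bracket_T : ∀ r c, good r c →
      (X : K⟦X⟧) ^ N ∣ d₁.coeffwise.bracket d₂.coeffwise p (T r c))
    (coeff_T : ∀ j r c, j < r → coeff j (T r c) = 0)
    (inj_T : ∀ r c c', good r c → good r c' → coeff r (T r c) = coeff r (T r c') → c = c')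
    (mem_T : ∀ n r c, good r c → coeff n (T r c) ∈ H n) (mem_q : ∀ n, coeff n q ∈ H n)
    (surj_T : ∀ n a, a ∈ H n → d₁.bracket d₂ (coeff 0 p) a = 0 →
      ∃ c, good n c ∧ coeff n (T n c) = a) :
    (X : K⟦X⟧) ^ N ∣ d₁.coeffwise.bracket d₂.coeffwise p q ↔
      ∃! lam : Fin N → L, (∀ r : Fin N, good r (lam r)) ∧
        ∀ j : Fin N, coeff j q = ∑ r ∈ Finset.Iic j, coeff j (T r (lam r)) := by
  have bracket_sum : ∀ (f : ℕ → L) (n : ℕ), (∀ r, good r (f r)) →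
      (X : K⟦X⟧) ^ N ∣ d₁.coeffwise.bracket d₂.coeffwise p (∑ r ∈ Finset.range n, T r (f r)) := by
    intro f n hf
    simp only [Derivation.bracket, map_sum, Finset.mul_sum, ← Finset.sum_sub_distrib]
    exact Finset.dvd_sum fun r _ => bracket_T r _ (hf r)
  have cond_iff : ∀ f : ℕ → L, (X : K⟦X⟧) ^ N ∣ q - ∑ r ∈ Finset.range N, T r (f r) ↔
      ∀ j : Fin N, coeff j q = ∑ r ∈ Finset.Iic j, coeff j (T r (f r)) := by
    intro f
    rw [X_pow_dvd_iff, Fin.forall_iff]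
    refine forall₂_congr fun j hj => ?_
    rw [map_sub, sub_eq_zero, map_sum, ← Fin.sum_univ_eq_sum_range (fun r => coeff j (T r (f r))) N]
    rw [← Finset.sum_subset (Finset.subset_univ (Finset.Iic (⟨j, hj⟩ : Fin N)))]
    intro r _ hr
    exact coeff_T _ _ _ (Fin.lt_def.1 (by simpa using hr))
  have ext_fun : ∀ lam : Fin N → L, (∀ r : Fin N, good r (lam r)) →
      ∃ f : ℕ → L, (∀ r, good r (f r)) ∧ ∀ r : Fin N, f r = lam r := by
    intro lam hlam
    refine ⟨fun r => if h : r < N then lam ⟨r, h⟩ else 0, fun r => ?_, fun r => by simp⟩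
    by_cases h : r < N
    · simpa [h] using hlam ⟨r, h⟩
    · simpa [h] using good_zero r
  constructor
  · intro hpq
    have build : ∀ n ≤ N, ∃ f : ℕ → L, (∀ r, good r (f r)) ∧
        (X : K⟦X⟧) ^ n ∣ q - ∑ r ∈ Finset.range n, T r (f r) := by
      intro n
      induction n with
      | zero => exact fun _ => ⟨fun _ => 0, good_zero, by simp⟩
      | succ n ih =>
        intro hn
        obtain ⟨f, hf, hdvd⟩ := ih (by omega)
        set e := q - ∑ r ∈ Finset.range n, T r (f r) with he
        have hbe : (X : K⟦X⟧) ^ N ∣ d₁.coeffwise.bracket d₂.coeffwise p e := by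
          have : q = e + ∑ r ∈ Finset.range n, T r (f r) := by rw [he]; ring
          rw [this, Derivation.bracket_add_right] at hpq
          exact (dvd_add_left (bracket_sum f n hf)).1 hpq
        have hbn : d₁.bracket d₂ (coeff 0 p) (coeff n e) = 0 := by
          obtain ⟨w, hw⟩ := hdvd
          have hw' : coeff n e = coeff 0 w := by
            rw [hw]; simpa using coeff_X_pow_mul w n 0
          have hb : d₁.coeffwise.bracket d₂.coeffwise p e =
              X ^ n * d₁.coeffwise.bracket d₂.coeffwise p w := by
            simp only [Derivation.bracket, hw, Derivation.leibniz, Derivation.leibniz_pow,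
              Derivation.coeffwise_X, smul_eq_mul, mul_zero, smul_zero, add_zero]
            ring
          have h0 := (X_pow_dvd_iff.1 hbe) n (by omega)
          rw [hb] at h0
          have h1 := coeff_X_pow_mul (d₁.coeffwise.bracket d₂.coeffwise p w) n 0
          rw [zero_add, h0] at h1
          rw [hw']
          simpa [Derivation.bracket] using h1.symm
        have hmem : coeff n e ∈ H n := by
          rw [he, map_sub, map_sum]
          exact (H n).sub_mem (mem_q n) ((H n).sum_mem fun r _ => mem_T n r _ (hf r))
        obtain ⟨c, hc, hce⟩ := surj_T n _ hmem hbn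
        refine ⟨Function.update f n c, fun r => ?_, ?_⟩
        · rcases eq_or_ne r n with rfl | hr
          · simpa using hc
          · simpa [hr] using hf r
        · have hsum : ∑ r ∈ Finset.range n, T r (Function.update f n c r) =
              ∑ r ∈ Finset.range n, T r (f r) := by
            refine Finset.sum_congr rfl fun r hr => ?_
            rw [Function.update_of_ne (Finset.mem_range.1 hr).ne]
          rw [Finset.sum_range_succ, hsum, Function.update_self, ← sub_sub, ← he, X_pow_dvd_iff]
          intro m hm
          rcases Nat.lt_succ_iff_lt_or_eq.1 hm with h | rfl
          · rw [map_sub, X_pow_dvd_iff.1 hdvd m h, coeff_T m n c h, sub_zero]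
          · rw [map_sub, hce, sub_self]
    obtain ⟨f, hf, hdvd⟩ := build N le_rfl
    refine ⟨fun r => f r, ⟨fun r => hf r, (cond_iff f).1 hdvd⟩, ?_⟩
    rintro lam ⟨hgood, hlam⟩
    have hq := (cond_iff f).1 hdvd
    ext r
    obtain ⟨r, hr⟩ := r
    induction r using Nat.strong_induction_on with
    | _ r ih =>
      have h := (hlam ⟨r, hr⟩).symm.trans (hq ⟨r, hr⟩)
      rw [← Finset.Iio_insert, Finset.sum_insert (by simp), Finset.sum_insert (by simp)] at h
      have hs : ∑ x ∈ Finset.Iio (⟨r, hr⟩ : Fin N), coeff r (T x (lam x)) =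
          ∑ x ∈ Finset.Iio (⟨r, hr⟩ : Fin N), coeff r (T x (f x)) := by
        refine Finset.sum_congr rfl fun x hx => ?_
        rw [ih x (by simpa [Fin.lt_def] using hx) x.2]
      simp only [hs] at h
      exact inj_T r _ _ (hgood ⟨r, hr⟩) (hf r) (add_right_cancel h)
  · rintro ⟨lam, ⟨hgood, hlam⟩, -⟩
    obtain ⟨f, hf, hfl⟩ := ext_fun lam hgood
    have hdvd := (cond_iff f).2 (by simpa only [hfl] using hlam)
    have : q = (q - ∑ r ∈ Finset.range N, T r (f r)) + ∑ r ∈ Finset.range N, T r (f r) := by ring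
    rw [this, Derivation.bracket_add_right]
    refine dvd_add ?_ (bracket_sum f N hf)
    exact dvd_sub (Dvd.dvd.mul_left (d₂.X_pow_dvd_coeffwise hdvd) _)
      (Dvd.dvd.mul_left (d₁.X_pow_dvd_coeffwise hdvd) _)

end Integration

section GradedSeries

variable {R K : Type*} [CommRing R] [Field K] [Algebra R K]

/-- Series whose `n`-th coefficient is an eigenvector of `E` with eigenvalue `δ - n`. -/
def gradedSeries (E : Derivation R K K) (δ : ℤ) : AddSubgroup K⟦X⟧ where
  carrier := {f | ∀ n : ℕ, E (coeff n f) = ((δ - n : ℤ) : K) * coeff n f}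
  zero_mem' := by simp
  add_mem' := fun hf hg n => by simp only [map_add, hf n, hg n]; ring
  neg_mem' := fun hf n => by simp only [map_neg, hf n]; ring

variable {E : Derivation R K K}

theorem gradedSeries_mul {δ ε : ℤ} {f g : K⟦X⟧} (hf : f ∈ gradedSeries E δ)
    (hg : g ∈ gradedSeries E ε) : f * g ∈ gradedSeries E (δ + ε) := by
  intro n
  rw [coeff_mul, map_sum, Finset.mul_sum]
  refine Finset.sum_congr rfl fun x hx => ?_
  rw [E.leibniz, hf, hg, ← show x.1 + x.2 = n by simpa using hx]
  push_cast
  simp only [smul_eq_mul]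
  ring

theorem gradedSeries_C {δ : ℤ} {a : K} (ha : E a = δ * a) : C a ∈ gradedSeries E δ := by
  intro n
  rw [coeff_C]
  split_ifs with h
  · simp [ha, h]
  · simp

theorem gradedSeries_X_pow (r : ℕ) : (X : K⟦X⟧) ^ r ∈ gradedSeries E r := by
  intro n
  rw [coeff_X_pow]
  split_ifs with h
  · simp [h]
  · simp

theorem mul_derivation_zpow (d : Derivation R K K) {G : K} (hG : G ≠ 0) (e : ℤ) :
    G * d (G ^ e) = e * G ^ e * d G := by
  rw [d.leibniz_zpow, zsmul_eq_mul, smul_eq_mul, zpow_sub_one₀ hG]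
  field_simp

end GradedSeries

section ExpansionTerm

variable {R K : Type*} [CommRing R] [Field K] [CharZero K] [Algebra R K]

/-- The series `a X ^ r (G ^ e (1 + u) ^ t)`, with the binomial series truncated after `u ^ N`. -/
noncomputable def expansionTerm (N : ℕ) (u : K⟦X⟧) (G a : K) (r : ℕ) (e : ℤ) (t : ℚ) : K⟦X⟧ :=
  X ^ r * (C (a * G ^ e) * truncBinom t N u)

theorem X_pow_dvd_bracket_expansionTerm (d₁ d₂ : Derivation R K K) (N : ℕ) {u : K⟦X⟧}
    (hu : X ∣ u) {G a : K} (hG : G ≠ 0) (ha₁ : d₁ a = 0) (ha₂ : d₂ a = 0) (r s : ℕ) (hs : s ≠ 0)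
    (e : ℤ) (t : ℚ) (ht : (s : ℚ) * t = e) :
    (X : K⟦X⟧) ^ N ∣ d₁.coeffwise.bracket d₂.coeffwise (C (G ^ s) * (1 + u))
      (expansionTerm N u G a r e t) := by
  set p : K⟦X⟧ := C (G ^ s) * (1 + u) with hp
  set T := expansionTerm N u G a r e t with hT
  have key : ∀ d : Derivation R K K, d a = 0 →
      (X : K⟦X⟧) ^ N ∣ C G * (s * p * d.coeffwise T - e * T * d.coeffwise p) := by
    intro d ha
    have h1 : (C G : K⟦X⟧) * C (d (G ^ e)) = e * C (G ^ e) * C (d G) := by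
      rw [← map_mul, mul_derivation_zpow d hG]; simp
    have h2 : (C G : K⟦X⟧) * C (d (G ^ s)) = s * C (G ^ s) * C (d G) := by
      have := mul_derivation_zpow d hG (s : ℤ)
      rw [zpow_natCast] at this
      rw [← map_mul, this]; simp
    have h3 := truncBinom_derivation d.coeffwise t N u
    have h4 : (s : K⟦X⟧) * algebraMap ℚ K⟦X⟧ t = e := by
      rw [← map_natCast (algebraMap ℚ K⟦X⟧), ← map_mul, ht, map_intCast]
    have : C G * ((s : K⟦X⟧) * p * d.coeffwise T - (e : K⟦X⟧) * T * d.coeffwise p) =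
        u ^ N * (C a * X ^ r * C G * C (G ^ s) * C (G ^ e) * (s : K⟦X⟧) *
          algebraMap ℚ K⟦X⟧ ((N - t) * binomCoeff t N) * d.coeffwise u) := by
      rw [hp, hT, expansionTerm]
      generalize G ^ s = A at h2 ⊢
      generalize G ^ e = B at h1 ⊢
      simp only [map_zero, Derivation.leibniz, Derivation.leibniz_pow, map_mul,
        map_add, Derivation.coeffwise_X, Derivation.coeffwise_C, ha, smul_eq_mul, mul_zero,
        smul_zero, add_zero, zero_add, Derivation.map_one_eq_zero]
      set F := truncBinom t N u
      simp only [map_mul] at h3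
      linear_combination (C a * X ^ r * C G * C A * C B * s) * h3
        + (C a * X ^ r * s * C A * (1 + u) * F) * h1
        - (C a * X ^ r * e * C B * (1 + u) * F) * h2
        + (C a * X ^ r * C G * C A * C B * F * d.coeffwise u) * h4
    rw [this]
    exact Dvd.dvd.mul_right (pow_dvd_pow_of_dvd hu N) _
  have hu0 : constantCoeff u = 0 := X_dvd_iff.1 hu
  have hunit : IsUnit (C G * ((s : K⟦X⟧) * p)) := by
    rw [isUnit_iff_constantCoeff, isUnit_iff_ne_zero]
    simp [hp, hu0, hG, hs]
  rw [← hunit.dvd_mul_left]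
  have : C G * ((s : K⟦X⟧) * p) * d₁.coeffwise.bracket d₂.coeffwise p T =
      d₁.coeffwise p * (C G * (s * p * d₂.coeffwise T - e * T * d₂.coeffwise p)) -
        d₂.coeffwise p * (C G * (s * p * d₁.coeffwise T - e * T * d₁.coeffwise p)) := by
    simp only [Derivation.bracket]; ring
  rw [this]
  exact dvd_sub (Dvd.dvd.mul_left (key d₂ ha₂) _) (Dvd.dvd.mul_left (key d₁ ha₁) _)

theorem coeff_expansionTerm_of_lt (N : ℕ) (u : K⟦X⟧) (G a : K) {j r : ℕ} (e : ℤ) (t : ℚ)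
    (h : j < r) : coeff j (expansionTerm N u G a r e t) = 0 :=
  X_pow_dvd_iff.1 (Dvd.intro _ rfl) j h

theorem coeff_expansionTerm (N : ℕ) (u : K⟦X⟧) (G a : K) (n r : ℕ) (e : ℤ) (t : ℚ) :
    coeff (n + r) (expansionTerm N u G a r e t) = a * G ^ e * coeff n (truncBinom t N u) := by
  rw [expansionTerm, coeff_X_pow_mul, coeff_C_mul]

theorem coeff_expansionTerm_self (N : ℕ) {u : K⟦X⟧} (hu : X ∣ u) (G a : K) (r : ℕ) (e : ℤ)
    (t : ℚ) : coeff r (expansionTerm N u G a r e t) = a * G ^ e := by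
  have h := coeff_expansionTerm N u G a 0 r e t
  rw [zero_add] at h
  have hu0 : constantCoeff u = 0 := X_dvd_iff.1 hu
  rw [h, truncBinom, Finset.sum_range_succ']
  simp [hu0, binomCoeff_zero]

variable {E : Derivation R K K}

theorem derivation_ratCast (d : Derivation R K K) (q : ℚ) : d (q : K) = 0 := by
  rw [← mul_one (q : K), ← Rat.smul_def, map_rat_smul, d.map_one_eq_zero, smul_zero]

theorem gradedSeries_truncBinom {u : K⟦X⟧} (hu : u ∈ gradedSeries E 0) (t : ℚ) (N : ℕ) :
    truncBinom t N u ∈ gradedSeries E 0 := by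
  have hpow : ∀ m : ℕ, u ^ m ∈ gradedSeries E 0 := by
    intro m
    induction m with
    | zero => simpa using gradedSeries_X_pow (E := E) 0
    | succ m ih => simpa [pow_succ] using gradedSeries_mul ih hu
  refine AddSubgroup.sum_mem _ fun m _ => ?_
  have hC : algebraMap ℚ K⟦X⟧ (binomCoeff t m) = C ((binomCoeff t m : ℚ) : K) := by
    rw [PowerSeries.algebraMap_apply, eq_ratCast]
  have h := gradedSeries_mul (gradedSeries_C (E := E) (δ := 0) (a := ((binomCoeff t m : ℚ) : K))
    (by rw [derivation_ratCast, Int.cast_zero, zero_mul])) (hpow m)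
  rw [hC]
  simpa using h

theorem expansionTerm_mem_gradedSeries {u : K⟦X⟧} (hu : u ∈ gradedSeries E 0) {G a : K} {g : ℤ}
    (hG : G ≠ 0) (hE : E G = g * G) (ha : E a = 0) (N r : ℕ) (e : ℤ) (t : ℚ) :
    expansionTerm N u G a r e t ∈ gradedSeries E (r + (g * e)) := by
  have h : C (a * G ^ e) ∈ gradedSeries E (g * e) := by
    refine gradedSeries_C ?_
    have := mul_derivation_zpow E hG e
    apply mul_left_cancel₀ hG
    rw [E.leibniz, ha]
    push_cast
    simp only [smul_eq_mul]
    rw [hE] at this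
    linear_combination a * this
  simpa only [expansionTerm, add_zero] using gradedSeries_mul (gradedSeries_X_pow r)
    (gradedSeries_mul h (gradedSeries_truncBinom hu t N))

end ExpansionTerm

section Coefficients

variable {K : Type*} [Field K] [CharZero K]

theorem msize_le_ssize (a : ℕ+ →₀ ℕ) : msize a ≤ ssize a :=
  Finset.sum_le_sum fun i _ => Nat.le_mul_of_pos_left _ i.pos

theorem le_ssize {a : ℕ+ →₀ ℕ} {i : ℕ+} (h : i ∈ a.support) : (i : ℕ) ≤ ssize a :=
  (Nat.le_mul_of_pos_right _ (Nat.pos_of_ne_zero (Finsupp.mem_support_iff.1 h))).trans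
    (Finset.single_le_sum (f := fun i : ℕ+ => (i : ℕ) * a i) (fun _ _ => Nat.zero_le _) h)

theorem mcoeff_eq (t : ℚ) (a : ℕ+ →₀ ℕ) :
    mcoeff t a = binomCoeff t (msize a) * (a.multinomial : ℚ) := by
  have h : gfact a * a.multinomial = (msize a).factorial :=
    Nat.multinomial_spec a.support a
  have h1 : (gfact a : ℚ) ≠ 0 := by
    exact_mod_cast (Finset.prod_pos fun i _ => Nat.factorial_pos (a i)).ne'
  have h2 : ((msize a).factorial : ℚ) ≠ 0 := by exact_mod_cast Nat.factorial_ne_zero _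
  rw [mcoeff, binomCoeff]
  field_simp
  rw [← h]
  push_cast
  ring

theorem sum_pow_eq_sum_finsuppAntidiag {A ι : Type*} [CommSemiring A] [DecidableEq ι]
    (S : Finset ι) (f : ι → A) (m : ℕ) :
    (∑ i ∈ S, f i) ^ m =
      ∑ a ∈ S.finsuppAntidiag m, (a.multinomial : A) * ∏ i ∈ a.support, f i ^ a i := by
  rw [Finset.sum_pow_eq_sum_piAntidiag]
  symm
  refine Finset.sum_bij (fun a _ => (a : ι → ℕ)) (fun a ha => ?_)
    (fun a _ b _ h => DFunLike.coe_injective h) (fun b hb => ?_) (fun a ha => ?_)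
  · rw [Finset.mem_finsuppAntidiag] at ha
    rw [Finset.mem_piAntidiag]
    exact ⟨ha.1, fun i hi => ha.2 (Finsupp.mem_support_iff.2 hi)⟩
  · rw [Finset.mem_piAntidiag] at hb
    refine ⟨Finsupp.onFinset S b fun i hi => hb.2 i hi, ?_, rfl⟩
    rw [Finset.mem_finsuppAntidiag]
    exact ⟨hb.1, Finsupp.support_onFinset_subset⟩
  · rw [Finset.mem_finsuppAntidiag] at ha
    rw [Finsupp.multinomial_of_support_subset ha.2]
    congr 1
    refine Finset.prod_subset ha.2 fun i _ hi => ?_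
    rw [Finsupp.notMem_support_iff.1 hi, pow_zero]

theorem coeff_truncBinom_sum (S : Finset ℕ+) (v : ℕ+ → K) (t : ℚ) {n N : ℕ} (hn : n ≤ N)
    (hS : ∀ i : ℕ+, (i : ℕ) ≤ n → i ∈ S) :
    coeff n (truncBinom t N (∑ i ∈ S, C (v i) * X ^ (i : ℕ))) =
      ∑ᶠ a ∈ {a : ℕ+ →₀ ℕ | ssize a = n}, ((mcoeff t a : ℚ) : K) * ∏ i ∈ a.support, v i ^ a i := by
  classical
  set F : Finset (ℕ+ →₀ ℕ) :=
    ((Finset.range (N + 1)).biUnion fun m => S.finsuppAntidiag m).filter (fun a => ssize a = n)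
    with hF
  have hset : {a : ℕ+ →₀ ℕ | ssize a = n} = ↑F := by
    ext a
    simp only [hF, Set.mem_ofPred_eq, Finset.coe_filter, Finset.mem_biUnion, Finset.mem_range,
      Finset.mem_finsuppAntidiag']
    refine ⟨fun h => ⟨⟨msize a, ?_, rfl, fun i hi => hS i ?_⟩, h⟩, fun h => h.2⟩
    · have := msize_le_ssize a; omega
    · exact h ▸ le_ssize hi
  rw [hset, finsum_mem_coe_finset, hF, Finset.sum_filter, Finset.sum_biUnion, truncBinom, map_sum]
  · refine Finset.sum_congr rfl fun m _ => ?_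
    rw [sum_pow_eq_sum_finsuppAntidiag, Finset.mul_sum, map_sum]
    refine Finset.sum_congr rfl fun a ha => ?_
    rw [Finset.mem_finsuppAntidiag'] at ha
    have hm : msize a = m := ha.1
    have hprod : ∏ i ∈ a.support, (C (v i) * (X : K⟦X⟧) ^ (i : ℕ)) ^ a i =
        C (∏ i ∈ a.support, v i ^ a i) * X ^ ssize a := by
      simp only [mul_pow, Finset.prod_mul_distrib, ← pow_mul, Finset.prod_pow_eq_pow_sum, map_prod,
        map_pow]
      rfl
    rw [hprod, mcoeff_eq, hm, PowerSeries.algebraMap_apply, eq_ratCast,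
      ← map_natCast (C : K →+* K⟦X⟧), coeff_C_mul, coeff_C_mul, coeff_C_mul, coeff_X_pow]
    simp only [eq_comm (a := n)]
    split_ifs
    · push_cast; ring
    · simp
  · intro m _ m' _ hmm
    rw [Function.onFun, Finset.disjoint_left]
    intro a ha ha'
    rw [Finset.mem_finsuppAntidiag'] at ha ha'
    exact hmm (ha.1.symm.trans ha'.1)

end Coefficients

end PowerSeries

section Derivations

theorem Derivation.exists_extension {R A : Type*} (K : Type*) [CommRing R] [CommRing A] [IsDomain A]
    [Field K] [Algebra R A] [Algebra A K] [Algebra R K] [IsScalarTower R A K]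
    [IsFractionRing A K] (d : Derivation R A A) :
    ∃ D : Derivation R K K, ∀ a, D (algebraMap A K a) = algebraMap A K (d a) := by
  have hloc := KaehlerDifferential.isLocalizedModule_map R A K (nonZeroDivisors A)
  let g : Derivation R A K := (Algebra.linearMap A K).compDer d
  have hunit : ∀ x : nonZeroDivisors A, IsUnit (algebraMap A (Module.End A K) x) := by
    intro x
    have h0 : algebraMap A K x ≠ 0 := IsFractionRing.to_map_ne_zero_of_mem_nonZeroDivisors x.2
    rw [Module.End.isUnit_iff]
    refine ⟨fun a b hab => ?_, fun b => ⟨(algebraMap A K x)⁻¹ * b, ?_⟩⟩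
    · simp only [Module.algebraMap_end_apply, Algebra.smul_def] at hab
      exact mul_left_cancel₀ h0 hab
    · simp only [Module.algebraMap_end_apply, Algebra.smul_def]
      field_simp
  let L : Ω[K⁄R] →ₗ[A] K := IsLocalizedModule.lift (nonZeroDivisors A)
    (KaehlerDifferential.map R R A K) g.liftKaehlerDifferential hunit
  refine ⟨(L.extendScalarsOfIsLocalization (nonZeroDivisors A) K).compDer
    (KaehlerDifferential.D R K), fun a => ?_⟩
  have h := IsLocalizedModule.lift_apply (nonZeroDivisors A)
    (KaehlerDifferential.map R R A K) g.liftKaehlerDifferential hunit (KaehlerDifferential.D R A a)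
  rw [KaehlerDifferential.map_D, Derivation.liftKaehlerDifferential_comp_D] at h
  exact h

variable {F K : Type*} [Field F] [IsAlgClosed F] [Field K] [CharZero K] [Algebra F K]

theorem exists_eq_mul_zpow_of_bracket_eq_zero (d₁ d₂ : Derivation F K K)
    (hconst : ∀ f : K, d₁ f = 0 → d₂ f = 0 → ∃ c : F, f = algebraMap F K c) (x y : K) {G f : K}
    (hG : G ≠ 0) (hsimple : ∀ m : ℕ, 1 ≤ m → ∀ z : K, G = z ^ m → m = 1) {g : ℕ} (hg : 1 ≤ g)
    (hEG : x * d₁ G + y * d₂ G = g * G) {δ : ℤ} (hf : f ≠ 0) (hEf : x * d₁ f + y * d₂ f = δ * f)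
    (hbr : d₁ G * d₂ f - d₂ G * d₁ f = 0) :
    ∃ (m : ℤ) (c : F), δ = g * m ∧ f = algebraMap F K c * G ^ m := by
  have h₁ : δ * f * d₁ G = g * G * d₁ f := by
    linear_combination d₁ f * hEG - d₁ G * hEf + y * hbr
  have h₂ : δ * f * d₂ G = g * G * d₂ f := by
    linear_combination d₂ f * hEG - d₂ G * hEf - x * hbr
  have hgz : (g : ℤ) ≠ 0 := by omega
  obtain ⟨e, g', δ', he, hcop, hge, hδe⟩ : ∃ e g' δ' : ℤ, 0 < e ∧ IsCoprime g' δ' ∧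
      (g : ℤ) = e * g' ∧ δ = e * δ' := by
    have hpos : 0 < Int.gcd g δ := Int.gcd_pos_of_ne_zero_left _ hgz
    obtain ⟨a, b, hab, ha, hb⟩ := Int.exists_gcd_one hpos
    exact ⟨Int.gcd g δ, a, b, by exact_mod_cast hpos, Int.isCoprime_iff_gcd_eq_one.2 hab,
      ha.trans (mul_comm _ _), hb.trans (mul_comm _ _)⟩
  have heK : (e : K) ≠ 0 := by exact_mod_cast he.ne'
  have hgK : (g : K) = e * g' := by exact_mod_cast congrArg (Int.cast : ℤ → K) hge
  have hδK : (δ : K) = e * δ' := by exact_mod_cast congrArg (Int.cast : ℤ → K) hδe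
  have hder : ∀ d : Derivation F K K, δ * f * d G = g * G * d f →
      d (f ^ g' * G ^ (-δ')) = 0 := by
    intro d hd
    have hd' : (δ' : K) * f * d G = g' * G * d f := by
      rw [hgK, hδK] at hd
      apply mul_left_cancel₀ heK
      linear_combination hd
    have hz₁ := PowerSeries.mul_derivation_zpow d hf g'
    have hz₂ := PowerSeries.mul_derivation_zpow d hG (-δ')
    apply mul_left_cancel₀ (mul_ne_zero hf hG)
    rw [d.leibniz, smul_eq_mul, smul_eq_mul]
    push_cast at hz₂
    linear_combination (f * f ^ g') * hz₂ + (G * G ^ (-δ')) * hz₁ - f ^ g' * G ^ (-δ') * hd'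
  obtain ⟨c, hc⟩ := hconst _ (hder d₁ h₁) (hder d₂ h₂)
  have hfc : f ^ g' = algebraMap F K c * G ^ δ' := by
    rw [← hc, mul_assoc, ← zpow_add₀ hG]; simp
  have hc0 : algebraMap F K c ≠ 0 := by
    rw [← hc]; exact mul_ne_zero (zpow_ne_zero _ hf) (zpow_ne_zero _ hG)
  have hcF : c ≠ 0 := by rintro rfl; simp at hc0
  have hg'pos : 0 < g' := pos_of_mul_pos_right (hge ▸ (by omega : (0 : ℤ) < g)) he.le
  obtain ⟨g'', rfl⟩ := Int.eq_ofNat_of_zero_le hg'pos.le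
  have hg''pos : 0 < g'' := by exact_mod_cast hg'pos
  obtain ⟨u, v, huv⟩ := hcop
  obtain ⟨b, hb⟩ := IsAlgClosed.exists_pow_nat_eq (c ^ (-v)) hg''pos
  have hpow : G = (algebraMap F K b * (G ^ u * f ^ v)) ^ g'' := by
    have hb' : algebraMap F K b ^ g'' = algebraMap F K c ^ (-v) := by
      rw [← map_pow, hb, map_zpow₀]
    have hfv : (f ^ v) ^ g'' = (algebraMap F K c) ^ v * G ^ (δ' * v) := by
      rw [← zpow_natCast, ← zpow_mul, mul_comm v, zpow_mul, hfc, mul_zpow, ← zpow_mul]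
    have hGu : (G ^ u) ^ g'' = G ^ (u * g'') := by
      rw [← zpow_natCast, ← zpow_mul]
    rw [mul_pow, mul_pow, hb', hGu, hfv]
    calc G = G ^ (u * g'' + v * δ') := by rw [huv, zpow_one]
      _ = G ^ (u * g'') * G ^ (δ' * v) := by rw [zpow_add₀ hG, mul_comm v]
      _ = _ := by rw [zpow_neg]; field_simp
  have hone : g'' = 1 := hsimple g'' hg''pos _ hpow
  subst hone
  refine ⟨δ', c, ?_, ?_⟩
  · rw [hδe, hge]; simp
  · simpa using hfc

end Derivations

section Components

theorem hcomp_isHomogeneous (P : MvPolynomial (Fin 2) ℂ) {m : ℤ} {n : ℕ} (h : m = n) :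
    (hcomp P m).IsHomogeneous n := by
  subst h
  simpa [hcomp] using homogeneousComponent_isHomogeneous n P

theorem hcomp_natCast (P : MvPolynomial (Fin 2) ℂ) (n : ℕ) :
    hcomp P n = homogeneousComponent n P := by
  simp [hcomp]

theorem hcomp_of_neg (P : MvPolynomial (Fin 2) ℂ) {m : ℤ} (h : m < 0) : hcomp P m = 0 :=
  if_neg (not_le.2 h)

theorem sum_hcomp_sub {P : MvPolynomial (Fin 2) ℂ} {k M : ℕ} (h : P.totalDegree = k) (hM : k ≤ M) :
    ∑ i ∈ Finset.range (M + 1), hcomp P ((k : ℤ) - (i : ℕ)) = P := by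
  rw [← Finset.sum_subset (Finset.range_mono (by omega : k + 1 ≤ M + 1))]
  · conv_rhs => rw [← sum_homogeneousComponent P, h, ← Finset.sum_range_reflect]
    refine Finset.sum_congr rfl fun i hi => ?_
    have hi' := Finset.mem_range.1 hi
    rw [← hcomp_natCast]
    congr 1
    omega
  · intro i _ hi
    rw [Finset.mem_range] at hi
    exact hcomp_of_neg P (by omega)

theorem pderiv_hcomp_of_nonpos (P : MvPolynomial (Fin 2) ℂ) {m : ℤ} (h : m ≤ 0) (i : Fin 2) :
    pderiv i (hcomp P m) = 0 := by
  rcases h.lt_or_eq with h | rfl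
  · rw [hcomp_of_neg P h, map_zero]
  · have h0 := hcomp_natCast P 0
    rw [Nat.cast_zero] at h0
    rw [h0, homogeneousComponent_zero, pderiv_C]

theorem jacDet_hcomp_isHomogeneous (P Q : MvPolynomial (Fin 2) ℂ) (a b : ℤ) {m : ℕ}
    (h : a + b = m + 2) : (jacDet (hcomp P a) (hcomp Q b)).IsHomogeneous m := by
  rcases le_or_gt a 0 with ha | ha
  · simpa [jacDet, pderiv_hcomp_of_nonpos P ha] using isHomogeneous_zero (Fin 2) ℂ m
  rcases le_or_gt b 0 with hb | hb
  · simpa [jacDet, pderiv_hcomp_of_nonpos Q hb] using isHomogeneous_zero (Fin 2) ℂ m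
  lift a to ℕ using ha.le
  lift b to ℕ using hb.le
  have hm : m = (a - 1) + (b - 1) := by omega
  subst hm
  exact ((hcomp_isHomogeneous P rfl).pderiv.mul (hcomp_isHomogeneous Q rfl).pderiv).sub
    ((hcomp_isHomogeneous P rfl).pderiv.mul (hcomp_isHomogeneous Q rfl).pderiv)

theorem jacDet_hcomp_eq_zero (P Q : MvPolynomial (Fin 2) ℂ) {a b : ℤ}
    (h : a + b < 2) : jacDet (hcomp P a) (hcomp Q b) = 0 := by
  rcases le_or_gt a 0 with ha | ha
  · simp [jacDet, pderiv_hcomp_of_nonpos P ha]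
  · simp [jacDet, pderiv_hcomp_of_nonpos Q (by omega : b ≤ 0)]

theorem homogeneousComponent_jacDet {P Q : MvPolynomial (Fin 2) ℂ} {k l : ℕ}
    (hP : P.totalDegree = k) (hQ : Q.totalDegree = l) (m : ℕ) :
    homogeneousComponent m (jacDet P Q) =
      ∑ x ∈ Finset.range (k + l + 1) ×ˢ Finset.range (k + l + 1), if x.1 + x.2 + m + 2 = k + l then
        jacDet (hcomp P ((k : ℤ) - (x.1 : ℕ))) (hcomp Q ((l : ℤ) - (x.2 : ℕ))) else 0 := by
  have h : jacDet P Q = ∑ x ∈ Finset.range (k + l + 1) ×ˢ Finset.range (k + l + 1),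
      jacDet (hcomp P ((k : ℤ) - (x.1 : ℕ))) (hcomp Q ((l : ℤ) - (x.2 : ℕ))) := by
    conv_lhs => rw [← sum_hcomp_sub hP (Nat.le_add_right k l),
      ← sum_hcomp_sub hQ (Nat.le_add_left l k)]
    simp only [jacDet, map_sum, Finset.sum_mul_sum, Finset.sum_product, Finset.sum_sub_distrib]
  rw [h, map_sum]
  refine Finset.sum_congr rfl fun x _ => ?_
  rcases lt_or_ge (k + l) (x.1 + x.2 + 2) with hx | hx
  · rw [jacDet_hcomp_eq_zero P Q (by omega), map_zero, if_neg (by omega)]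
  · rw [homogeneousComponent_of_mem (jacDet_hcomp_isHomogeneous P Q _ _
      (m := k + l - (x.1 + x.2 + 2)) (by omega))]
    exact if_congr (by omega) rfl rfl

theorem jacDet_eq_C_iff {P Q : MvPolynomial (Fin 2) ℂ} {k l : ℕ}
    (hP : P.totalDegree = k) (hQ : Q.totalDegree = l) :
    (∃ c : ℂ, jacDet P Q = C c) ↔ ∀ n < k + l - 2, ∑ x ∈ Finset.HasAntidiagonal.antidiagonal n,
      jacDet (hcomp P ((k : ℤ) - (x.1 : ℕ))) (hcomp Q ((l : ℤ) - (x.2 : ℕ))) = 0 := by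
  have hn : ∀ n < k + l - 2, ∑ x ∈ Finset.HasAntidiagonal.antidiagonal n,
      jacDet (hcomp P ((k : ℤ) - (x.1 : ℕ))) (hcomp Q ((l : ℤ) - (x.2 : ℕ))) =
        homogeneousComponent (k + l - 2 - n) (jacDet P Q) := by
    intro n hn
    rw [homogeneousComponent_jacDet hP hQ, ← Finset.sum_filter]
    refine Finset.sum_congr ?_ fun _ _ => rfl
    ext x
    simp only [Finset.HasAntidiagonal.mem_antidiagonal, Finset.mem_filter,
      Finset.mem_product, Finset.mem_range]
    omega
  have hm : ∀ m, k + l - 2 < m → homogeneousComponent m (jacDet P Q) = 0 := by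
    intro m hm
    rw [homogeneousComponent_jacDet hP hQ]
    exact Finset.sum_eq_zero fun x _ => if_neg (by omega)
  constructor
  · rintro ⟨c, hc⟩ n hlt
    rw [hn n hlt, hc, homogeneousComponent_of_mem (isHomogeneous_C _ c), if_neg (by omega)]
  · intro h
    refine ⟨coeff 0 (jacDet P Q), ?_⟩
    rw [← homogeneousComponent_zero]
    conv_lhs => rw [← sum_homogeneousComponent (jacDet P Q)]
    refine Finset.sum_eq_single_of_mem 0 (by simp) fun m _ hm0 => ?_
    rcases lt_or_ge (k + l - 2) m with h' | h'
    · exact hm m h'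
    · have := hn (k + l - 2 - m) (by omega)
      rw [h _ (by omega), show k + l - 2 - (k + l - 2 - m) = m by omega] at this
      exact this.symm

end Components

section FractionField

theorem eq_C_of_pderiv_eq_zero {f : MvPolynomial (Fin 2) ℂ} (h₀ : pderiv 0 f = 0)
    (h₁ : pderiv 1 f = 0) : f = C (coeff 0 f) := by
  ext m
  rw [coeff_C]
  split_ifs with h
  · rw [← h]
  · obtain ⟨i, hi⟩ := Finsupp.ne_iff.1 (Ne.symm h)
    have hp : pderiv i f = 0 := by fin_cases i <;> assumption
    have hc := coeff_pderiv f (i := i) (m - Finsupp.single i 1)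
    have hle : Finsupp.single i 1 ≤ m := by
      rw [Finsupp.single_le_iff]
      exact Nat.one_le_iff_ne_zero.2 hi
    rw [hp, coeff_zero, tsub_add_cancel_of_le hle] at hc
    refine (mul_eq_zero.1 hc.symm).resolve_right ?_
    exact_mod_cast Nat.succ_ne_zero ((m - Finsupp.single i (1 : ℕ)) i)

theorem totalDegree_pderiv_lt {f : MvPolynomial (Fin 2) ℂ} {i : Fin 2} (h : pderiv i f ≠ 0) :
    (pderiv i f).totalDegree < f.totalDegree := by
  obtain ⟨m, hm, hd⟩ := Finset.exists_mem_eq_sup _ (support_nonempty.2 h)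
    (fun m : Fin 2 →₀ ℕ => m.degree)
  have hd' : (pderiv i f).totalDegree = m.degree := hd
  rw [mem_support_iff, coeff_pderiv] at hm
  have hm' := le_totalDegree (mem_support_iff.2 (left_ne_zero_of_mul hm))
  rw [hd']
  have : (m + Finsupp.single i 1).degree = m.degree + 1 := by simp
  change (m + Finsupp.single i 1).degree ≤ _ at hm'
  omega

theorem pderiv_eq_zero_of_dvd {f : MvPolynomial (Fin 2) ℂ} {i : Fin 2} (h : f ∣ pderiv i f) :
    pderiv i f = 0 := by
  by_contra h0
  have hlt := totalDegree_pderiv_lt h0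
  obtain ⟨g, hg⟩ := h
  rw [hg] at h0 hlt
  rw [totalDegree_mul_of_isDomain (left_ne_zero_of_mul h0) (right_ne_zero_of_mul h0)] at hlt
  omega

theorem exists_eq_algebraMap_of_derivation_eq_zero {d₁ d₂ : Derivation ℂ FF FF}
    (h₁ : ∀ a, d₁ (algebraMap (MvPolynomial (Fin 2) ℂ) FF a) = algebraMap _ FF (pderiv 0 a))
    (h₂ : ∀ a, d₂ (algebraMap (MvPolynomial (Fin 2) ℂ) FF a) = algebraMap _ FF (pderiv 1 a))
    (f : FF) (hf₁ : d₁ f = 0) (hf₂ : d₂ f = 0) : ∃ c : ℂ, f = algebraMap ℂ FF c := by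
  obtain ⟨a, b, hrel, hab⟩ := IsFractionRing.exists_reduced_fraction (A := MvPolynomial (Fin 2) ℂ) f
  have hb0 : algebraMap (MvPolynomial (Fin 2) ℂ) FF b ≠ 0 :=
    IsFractionRing.to_map_ne_zero_of_mem_nonZeroDivisors b.2
  have hfb : f * algebraMap (MvPolynomial (Fin 2) ℂ) FF b = algebraMap _ FF a := by
    rw [← hab]; exact IsLocalization.mk'_spec _ _ _
  have key : ∀ (d : Derivation ℂ FF FF) (i : Fin 2), d f = 0 →
      (∀ a, d (algebraMap (MvPolynomial (Fin 2) ℂ) FF a) = algebraMap _ FF (pderiv i a)) →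
      pderiv i (b : MvPolynomial (Fin 2) ℂ) = 0 ∧ pderiv i a = 0 := by
    intro d i hd hi
    have hfd : f * algebraMap (MvPolynomial (Fin 2) ℂ) FF (pderiv i b) =
        algebraMap _ FF (pderiv i a) := by
      rw [← hi, ← hi, ← hfb, d.leibniz, hd]; simp
    have hcross : a * pderiv i (b : MvPolynomial (Fin 2) ℂ) = b * pderiv i a := by
      apply IsFractionRing.injective (MvPolynomial (Fin 2) ℂ) FF
      rw [map_mul, map_mul, ← hfb, ← hfd]; ring
    have hb : pderiv i (b : MvPolynomial (Fin 2) ℂ) = 0 :=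
      pderiv_eq_zero_of_dvd (hrel.symm.dvd_of_dvd_mul_left (Dvd.intro _ hcross.symm))
    refine ⟨hb, ?_⟩
    rw [hb, mul_zero] at hcross
    exact (mul_eq_zero.1 hcross.symm).resolve_left (nonZeroDivisors.coe_ne_zero b)
  obtain ⟨hb₁, ha₁⟩ := key d₁ 0 hf₁ h₁
  obtain ⟨hb₂, ha₂⟩ := key d₂ 1 hf₂ h₂
  have hC : ∀ c : ℂ, algebraMap (MvPolynomial (Fin 2) ℂ) FF (C c) = algebraMap ℂ FF c := fun c =>
    (IsScalarTower.algebraMap_apply ℂ (MvPolynomial (Fin 2) ℂ) FF c).symm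
  refine ⟨coeff 0 a / coeff 0 (b : MvPolynomial (Fin 2) ℂ), ?_⟩
  rw [eq_C_of_pderiv_eq_zero hb₁ hb₂, hC] at hb0 hfb
  rw [eq_C_of_pderiv_eq_zero ha₁ ha₂, hC] at hfb
  rw [map_div₀, eq_div_iff hb0, hfb]

theorem euler_algebraMap {d₁ d₂ : Derivation ℂ FF FF}
    (h₁ : ∀ a, d₁ (algebraMap (MvPolynomial (Fin 2) ℂ) FF a) = algebraMap _ FF (pderiv 0 a))
    (h₂ : ∀ a, d₂ (algebraMap (MvPolynomial (Fin 2) ℂ) FF a) = algebraMap _ FF (pderiv 1 a))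
    {f : MvPolynomial (Fin 2) ℂ} {n : ℕ} (hf : f.IsHomogeneous n) :
    algebraMap (MvPolynomial (Fin 2) ℂ) FF (X 0) * d₁ (algebraMap _ FF f) +
      algebraMap (MvPolynomial (Fin 2) ℂ) FF (X 1) * d₂ (algebraMap _ FF f) =
        n * algebraMap _ FF f := by
  have h := hf.sum_X_mul_pderiv
  rw [Fin.sum_univ_two, nsmul_eq_mul] at h
  rw [h₁, h₂, ← map_mul, ← map_mul, ← map_add, h, map_mul, map_natCast]

theorem eq_one_of_sVal_eq_one {R : FF} (h : sVal R = 1) {m : ℕ} (hm : 1 ≤ m) {z : FF}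
    (hz : R = z ^ m) : m = 1 := by
  have hbdd : BddAbove {m : ℕ | 1 ≤ m ∧ ∃ X : FF, R = X ^ m} := by
    by_contra hb
    rw [sVal, Nat.sSup_of_not_bddAbove hb] at h
    exact zero_ne_one h
  have := le_csSup hbdd ⟨hm, z, hz⟩
  change m ≤ sVal R at this
  omega

end FractionField

namespace PowerSeries

theorem coeff_expansionTerm_sum {K : Type*} [Field K] [CharZero K] (S : Finset ℕ+) (w : ℕ+ → K)
    {G : K} (hG : G ≠ 0) (a : K) (s : ℕ) (e : ℤ) (t : ℚ) {j r N : ℕ} (hr : r ≤ j) (hj : j ≤ N)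
    (hS : ∀ i : ℕ+, (i : ℕ) ≤ N → i ∈ S) :
    coeff j (expansionTerm N (∑ i ∈ S, C (w i / G ^ s) * X ^ (i : ℕ)) G a r e t) =
      ∑ᶠ α ∈ {α : ℕ+ →₀ ℕ | ssize α = j - r},
        a * ((mcoeff t α : ℚ) : K) * G ^ (e - (s : ℤ) * (msize α : ℤ)) *
          ∏ i ∈ α.support, w i ^ α i := by
  obtain ⟨n, rfl⟩ := Nat.exists_eq_add_of_le' hr
  rw [coeff_expansionTerm, coeff_truncBinom_sum S _ t (by omega) fun i hi => hS i (by omega),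
    ← smul_eq_mul, smul_finsum, Nat.add_sub_cancel]
  refine finsum_congr fun α => ?_
  rw [smul_finsum]
  refine finsum_congr fun _ => ?_
  have hprod : ∏ i ∈ α.support, (w i / G ^ s) ^ α i =
      (∏ i ∈ α.support, w i ^ α i) * G ^ (-((s : ℤ) * (msize α : ℤ))) := by
    simp only [div_pow, Finset.prod_div_distrib, Finset.prod_pow_eq_pow_sum]
    rw [zpow_neg, div_eq_mul_inv, zpow_mul, zpow_natCast, zpow_natCast]
    rfl
  rw [hprod, sub_eq_add_neg, zpow_add₀ hG, smul_eq_mul]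
  ring

end PowerSeries

section SeriesOfComponents

variable {d₁ d₂ : Derivation ℂ FF FF}

theorem euler_algebraMap_hcomp
    (h₁ : ∀ a, d₁ (algebraMap (MvPolynomial (Fin 2) ℂ) FF a) = algebraMap _ FF (pderiv 0 a))
    (h₂ : ∀ a, d₂ (algebraMap (MvPolynomial (Fin 2) ℂ) FF a) = algebraMap _ FF (pderiv 1 a))
    (P : MvPolynomial (Fin 2) ℂ) (m : ℤ) :
    algebraMap (MvPolynomial (Fin 2) ℂ) FF (X 0) * d₁ (algebraMap _ FF (hcomp P m)) +
      algebraMap (MvPolynomial (Fin 2) ℂ) FF (X 1) * d₂ (algebraMap _ FF (hcomp P m)) =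
        (m : FF) * algebraMap _ FF (hcomp P m) := by
  rcases lt_or_ge m 0 with hm | hm
  · simp [hcomp_of_neg P hm]
  · lift m to ℕ using hm
    simpa using euler_algebraMap h₁ h₂ (hcomp_isHomogeneous P (m := m) rfl)

theorem bracket_algebraMap
    (h₁ : ∀ a, d₁ (algebraMap (MvPolynomial (Fin 2) ℂ) FF a) = algebraMap _ FF (pderiv 0 a))
    (h₂ : ∀ a, d₂ (algebraMap (MvPolynomial (Fin 2) ℂ) FF a) = algebraMap _ FF (pderiv 1 a))
    (a b : MvPolynomial (Fin 2) ℂ) :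
    d₁.bracket d₂ (algebraMap _ FF a) (algebraMap _ FF b) = algebraMap _ FF (jacDet a b) := by
  simp [Derivation.bracket, jacDet, h₁, h₂]

theorem PowerSeries.X_pow_dvd_bracket_iff {R K : Type*} [CommRing R] [CommRing K] [Algebra R K]
    (d₁ d₂ : Derivation R K K) (N : ℕ) (p q : PowerSeries K) :
    (PowerSeries.X : PowerSeries K) ^ N ∣ d₁.coeffwise.bracket d₂.coeffwise p q ↔
      ∀ n < N, ∑ x ∈ Finset.HasAntidiagonal.antidiagonal n,
        d₁.bracket d₂ (PowerSeries.coeff x.1 p) (PowerSeries.coeff x.2 q) = 0 := by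
  rw [PowerSeries.X_pow_dvd_iff]
  simp only [Derivation.bracket, map_sub, PowerSeries.coeff_mul, Derivation.coeff_coeffwise,
    Finset.sum_sub_distrib]

theorem jacDet_const_iff_X_pow_dvd
    (h₁ : ∀ a, d₁ (algebraMap (MvPolynomial (Fin 2) ℂ) FF a) = algebraMap _ FF (pderiv 0 a))
    (h₂ : ∀ a, d₂ (algebraMap (MvPolynomial (Fin 2) ℂ) FF a) = algebraMap _ FF (pderiv 1 a))
    {P Q : MvPolynomial (Fin 2) ℂ} {k l : ℕ} (hP : P.totalDegree = k) (hQ : Q.totalDegree = l)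
    {p q : PowerSeries FF}
    (hp : ∀ n < k + l - 2, PowerSeries.coeff n p = algebraMap _ FF (hcomp P ((k : ℤ) - (n : ℕ))))
    (hq : ∀ n < k + l - 2, PowerSeries.coeff n q = algebraMap _ FF (hcomp Q ((l : ℤ) - (n : ℕ)))) :
    (∃ c : ℂ, jacDet P Q = C c) ↔
      (PowerSeries.X : PowerSeries FF) ^ (k + l - 2) ∣ d₁.coeffwise.bracket d₂.coeffwise p q := by
  rw [jacDet_eq_C_iff hP hQ, PowerSeries.X_pow_dvd_bracket_iff]
  refine forall₂_congr fun n hn => ?_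
  rw [← (IsFractionRing.injective (MvPolynomial (Fin 2) ℂ) FF).eq_iff, map_sum, map_zero]
  refine Eq.congr_left (Finset.sum_congr rfl fun x hx => ?_)
  rw [Finset.HasAntidiagonal.mem_antidiagonal] at hx
  rw [hp _ (by omega), hq _ (by omega), bracket_algebraMap h₁ h₂]

/-- The elements of `K` that are homogeneous of degree `δ` for the Euler derivation `E`. -/
def homogeneousElements {R K : Type*} [CommRing R] [CommRing K] [Algebra R K]
    (E : Derivation R K K) (δ : ℤ) : AddSubgroup K where
  carrier := {a | E a = δ * a}
  zero_mem' := by simp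
  add_mem' := fun {a b} ha hb => by
    simp only [Set.mem_ofPred_eq] at ha hb ⊢
    rw [map_add, ha, hb, mul_add]
  neg_mem' := fun {a} ha => by
    simp only [Set.mem_ofPred_eq] at ha ⊢
    rw [map_neg, ha, mul_neg]

end SeriesOfComponents

section Assembly

/-- The exponent of `G` in the `r`-th term, for the coefficient `c`. -/
noncomputable def expansionExponent (k l s r : ℕ) (c : ℂ) : ℤ :=
  if c = 0 then 0 else (s : ℤ) * ((l : ℤ) - (r : ℕ)) / (k : ℤ)

theorem expansionExponent_cast {k l s r : ℕ} {c : ℂ} (hk : k ≠ 0)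
    (h : c ≠ 0 → (k : ℤ) ∣ (s : ℤ) * ((l : ℤ) - (r : ℕ))) :
    (expansionExponent k l s r c : ℚ) =
      if c = 0 then ((0 : ℤ) : ℚ)
      else ((s : ℤ) : ℚ) * (((l : ℤ) : ℚ) - (((r : ℕ) : ℤ) : ℚ)) / ((k : ℤ) : ℚ) := by
  unfold expansionExponent
  split_ifs with hc
  · rfl
  · rw [Int.cast_div (h hc) (by exact_mod_cast hk)]
    push_cast
    rfl

theorem jacDet_const_iff_existsUnique_expansion (P Q G : MvPolynomial (Fin 2) ℂ) (k l s : ℕ)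
    (hdegP : P.totalDegree = k) (hdegQ : Q.totalDegree = l) (hk : 1 ≤ k)
    (hGhom : ∃ g : ℕ, G.IsHomogeneous g)
    (hGsimple : sVal (algebraMap (MvPolynomial (Fin 2) ℂ) FF G) = 1)
    (hGs : G ^ s = homogeneousComponent k P) :
    (∃ c : ℂ, jacDet P Q = C c) ↔
      ∃! lam : Fin (k + l - 2) → ℂ,
        (∀ r : Fin (k + l - 2), lam r ≠ 0 → (k : ℤ) ∣ (s : ℤ) * ((l : ℤ) - ((r : ℕ) : ℤ))) ∧
        ∀ j : Fin (k + l - 2),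
          algebraMap (MvPolynomial (Fin 2) ℂ) FF (hcomp Q ((l : ℤ) - ((j : ℕ) : ℤ))) =
            ∑ r ∈ Finset.Iic j,
              ∑ᶠ a ∈ {a : ℕ+ →₀ ℕ | ssize a = (j : ℕ) - (r : ℕ)},
                algebraMap ℂ FF (lam r) *
                  ((mcoeff ((expansionExponent k l s r (lam r) : ℚ) / (s : ℚ)) a : ℚ) : FF) *
                  (algebraMap (MvPolynomial (Fin 2) ℂ) FF G) ^
                    (expansionExponent k l s r (lam r) - (s : ℤ) * (msize a : ℤ)) *
                  ∏ i ∈ a.support,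
                    algebraMap (MvPolynomial (Fin 2) ℂ) FF
                      (hcomp P ((k : ℤ) - ((i : ℕ) : ℤ))) ^ a i := by
  obtain ⟨d₁, h₁⟩ := (pderiv (R := ℂ) (0 : Fin 2)).exists_extension FF
  obtain ⟨d₂, h₂⟩ := (pderiv (R := ℂ) (1 : Fin 2)).exists_extension FF
  obtain ⟨g, hg⟩ := hGhom
  have hPk : homogeneousComponent k P ≠ 0 := by
    intro h
    have hsum := sum_homogeneousComponent P
    rw [hdegP, Finset.sum_range_succ, h, add_zero] at hsum
    have hlt : P.totalDegree < k := by
      rw [← hsum]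
      refine (totalDegree_finsetSum_le (d := k - 1) fun i hi => ?_).trans_lt (by omega)
      have := (homogeneousComponent_isHomogeneous i P).totalDegree_le
      have := Finset.mem_range.1 hi
      omega
    exact hlt.ne hdegP
  have hgk : k = s * g := by
    rw [mul_comm]
    exact (homogeneousComponent_isHomogeneous k P).inj_right (hGs ▸ hg.pow s) hPk
  have hs : s ≠ 0 := by
    rintro rfl
    omega
  have hg1 : 1 ≤ g := by
    rw [Nat.one_le_iff_ne_zero]
    rintro rfl
    omega
  have hG0 : G ≠ 0 := by
    rintro rfl
    exact hPk (by rw [← hGs, zero_pow hs])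
  set N := k + l - 2 with hN
  set φ := algebraMap (MvPolynomial (Fin 2) ℂ) FF with hφ
  set Γ : FF := φ G with hΓ
  have hΓ0 : Γ ≠ 0 := (map_ne_zero_iff φ (IsFractionRing.injective _ FF)).2 hG0
  have hΓs : Γ ^ s = φ (hcomp P k) := by rw [hcomp_natCast, ← hGs, map_pow]
  set E : Derivation ℂ FF FF := φ (X 0) • d₁ + φ (X 1) • d₂ with hE
  have hE_apply : ∀ a, E a = φ (X 0) * d₁ a + φ (X 1) * d₂ a := fun a => by simp [hE]
  have hEh : ∀ (P : MvPolynomial (Fin 2) ℂ) (m : ℤ), E (φ (hcomp P m)) = m * φ (hcomp P m) :=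
    fun P m => (hE_apply _).trans (euler_algebraMap_hcomp h₁ h₂ P m)
  have hEG : E Γ = g * Γ := (hE_apply _).trans (euler_algebraMap h₁ h₂ hg)
  set S : Finset ℕ+ := Finset.Icc 1 N.succPNat with hS
  have hmemS : ∀ i : ℕ+, (i : ℕ) ≤ N → i ∈ S := by
    intro i hi
    rw [hS, Finset.mem_Icc]
    exact ⟨one_le, by rw [← PNat.coe_le_coe, Nat.succPNat_coe]; omega⟩
  set w : ℕ+ → FF := fun i => φ (hcomp P ((k : ℤ) - ((i : ℕ) : ℤ))) with hw
  set u : PowerSeries FF :=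
    ∑ i ∈ S, PowerSeries.C (w i / Γ ^ s) * PowerSeries.X ^ (i : ℕ) with hu
  have hXu : PowerSeries.X ∣ u := Finset.dvd_sum fun i _ =>
    Dvd.dvd.mul_left (dvd_pow_self _ i.pos.ne') _
  have huE : u ∈ PowerSeries.gradedSeries E 0 := by
    refine AddSubgroup.sum_mem _ fun i _ => ?_
    have hv : E (w i / Γ ^ s) = ((-(i : ℕ) : ℤ) : FF) * (w i / Γ ^ s) := by
      set v := w i / Γ ^ s with hv
      have hΓs0 : Γ ^ s ≠ 0 := pow_ne_zero s hΓ0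
      have hvw : v * Γ ^ s = w i := div_mul_cancel₀ _ hΓs0
      have h : E (v * Γ ^ s) = ((k - (i : ℕ) : ℤ) : FF) * (v * Γ ^ s) := by
        rw [hvw]; exact hEh P _
      rw [E.leibniz, hΓs, hEh, ← hΓs, smul_eq_mul, smul_eq_mul] at h
      apply mul_left_cancel₀ hΓs0
      push_cast at h ⊢
      linear_combination h
    simpa using PowerSeries.gradedSeries_mul (PowerSeries.gradedSeries_C hv)
      (PowerSeries.gradedSeries_X_pow (E := E) i)
  set p : PowerSeries FF := PowerSeries.C (Γ ^ s) * (1 + u) with hp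
  set q : PowerSeries FF := PowerSeries.mk fun n => φ (hcomp Q ((l : ℤ) - (n : ℕ))) with hq
  have hp_coeff : ∀ n < N, PowerSeries.coeff n p = φ (hcomp P ((k : ℤ) - (n : ℕ))) := by
    intro n hn
    have hcoeff : PowerSeries.coeff n u = ∑ i ∈ S, if n = i then w i / Γ ^ s else 0 := by
      simp [hu, PowerSeries.coeff_X_pow]
    rw [hp, PowerSeries.coeff_C_mul, map_add, hcoeff]
    rcases Nat.eq_zero_or_pos n with rfl | hn0
    · rw [Finset.sum_eq_zero fun i _ => if_neg i.pos.ne]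
      simp [hΓs]
    · lift n to ℕ+ using hn0
      rw [PowerSeries.coeff_one, if_neg n.pos.ne', zero_add, Finset.sum_eq_single_of_mem n
        (hmemS n hn.le) fun i _ hi => if_neg fun h => hi (PNat.eq h.symm), if_pos rfl,
        mul_div_cancel₀ _ (pow_ne_zero s hΓ0)]
  rw [jacDet_const_iff_X_pow_dvd h₁ h₂ hdegP hdegQ (p := p) (q := q) hp_coeff
    fun n _ => PowerSeries.coeff_mk _ _]
  have hda : ∀ (d : Derivation ℂ FF FF) (c : ℂ), d (algebraMap ℂ FF c) = 0 :=
    fun d c => d.map_algebraMap c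
  have hexp : ∀ r c, (c ≠ 0 → (k : ℤ) ∣ (s : ℤ) * ((l : ℤ) - (r : ℕ))) → c ≠ 0 →
      (g : ℤ) * expansionExponent k l s r c = l - r := by
    intro r c h hc
    obtain ⟨m, hm⟩ := h hc
    rw [expansionExponent, if_neg hc, hm, Int.mul_ediv_cancel_left _ (by omega)]
    apply mul_left_cancel₀ (by exact_mod_cast hs : (s : ℤ) ≠ 0)
    rw [hm, hgk]
    push_cast
    ring
  rw [PowerSeries.existsUnique_expansion d₁ d₂ N p q
    (fun r c => PowerSeries.expansionTerm N u Γ (algebraMap ℂ FF c) r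
      (expansionExponent k l s r c) ((expansionExponent k l s r c : ℚ) / (s : ℚ)))
    (fun r c => c ≠ 0 → (k : ℤ) ∣ (s : ℤ) * ((l : ℤ) - (r : ℕ)))
    (fun n => homogeneousElements E (l - n))]
  · refine existsUnique_congr fun lam => and_congr_right fun _ => forall_congr' fun j => ?_
    rw [hq, PowerSeries.coeff_mk]
    refine Eq.congr_right (Finset.sum_congr rfl fun r hr => ?_)
    exact PowerSeries.coeff_expansionTerm_sum S w hΓ0 _ s _ _
      (Fin.le_def.1 (Finset.mem_Iic.1 hr)) j.2.le hmemS
  · exact fun r h => absurd rfl h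
  · exact fun r c _ => PowerSeries.X_pow_dvd_bracket_expansionTerm d₁ d₂ N hXu hΓ0 (hda d₁ c)
      (hda d₂ c) r s hs _ _ (by field_simp)
  · exact fun j r c hjr => PowerSeries.coeff_expansionTerm_of_lt N u Γ _ _ _ hjr
  · intro r c c' _ _ h
    simp only [PowerSeries.coeff_expansionTerm_self N hXu] at h
    by_cases hc : c = 0 <;> by_cases hc' : c' = 0
    · rw [hc, hc']
    · simp [hc, hc', zpow_ne_zero _ hΓ0] at h
    · simp [hc, hc', zpow_ne_zero _ hΓ0] at h
    · simpa [expansionExponent, hc, hc', zpow_ne_zero _ hΓ0] using h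
  · intro n r c hc
    by_cases hc0 : c = 0
    · simp [PowerSeries.expansionTerm, hc0]
    · have := PowerSeries.expansionTerm_mem_gradedSeries huE hΓ0 (g := g) (by exact_mod_cast hEG)
        (hda E c) N r (expansionExponent k l s r c) ((expansionExponent k l s r c : ℚ) / (s : ℚ)) n
      rw [hexp r c hc hc0] at this
      change E _ = _
      rw [this]
      congr 2
      ring
  · exact fun n => by rw [hq, PowerSeries.coeff_mk]; exact hEh Q _
  · intro n a ha hbr
    by_cases ha0 : a = 0
    · exact ⟨0, fun h => absurd rfl h, by
        rw [PowerSeries.coeff_expansionTerm_self N hXu, ha0, map_zero, zero_mul]⟩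
    have hbr' : d₁ Γ * d₂ a - d₂ Γ * d₁ a = 0 := by
      have h0 : PowerSeries.coeff 0 p = Γ ^ s := by
        simp [hp, PowerSeries.X_dvd_iff.1 hXu]
      rw [h0, Derivation.bracket, d₁.leibniz_pow, d₂.leibniz_pow, smul_eq_mul, smul_eq_mul] at hbr
      have hne : (s : FF) * Γ ^ (s - 1) ≠ 0 :=
        mul_ne_zero (by exact_mod_cast hs) (pow_ne_zero _ hΓ0)
      apply mul_left_cancel₀ hne
      simp only [nsmul_eq_mul] at hbr
      linear_combination hbr
    obtain ⟨m, c, hm, hc⟩ := exists_eq_mul_zpow_of_bracket_eq_zero d₁ d₂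
      (exists_eq_algebraMap_of_derivation_eq_zero h₁ h₂) (φ (X 0)) (φ (X 1)) hΓ0
      (fun m hm z hz => eq_one_of_sVal_eq_one hGsimple hm hz) hg1
      ((hE_apply _).symm.trans hEG) ha0 ((hE_apply _).symm.trans ha) hbr'
    have hmul : (s : ℤ) * ((l : ℤ) - (n : ℕ)) = k * m := by
      rw [hm, hgk]; push_cast; ring
    refine ⟨c, fun _ => ⟨m, hmul⟩, ?_⟩
    have hc0 : c ≠ 0 := by
      rintro rfl
      simp [ha0] at hc
    rw [PowerSeries.coeff_expansionTerm_self N hXu, hc, expansionExponent, if_neg hc0, hmul,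
      Int.mul_ediv_cancel_left _ (by omega)]

end Assembly

/-- Main theorem: with `P(0) = Q(0) = 0`, `deg P = k ≥ 1`, `deg Q = l ≥ 1`, `k·l > 1`,
`s = s(P_k)`, and `G` a simple homogeneous polynomial with `G^s = P_k`, the Jacobian
determinant `D(P,Q)` is a constant iff there exist unique `λ_0, …, λ_{k+l-3} ∈ ℂ` such
that, with `s_r = s(l-r)/k` when `λ_r ≠ 0` (an integer in that case) and `s_r = 0`
when `λ_r = 0`, for all `0 ≤ j ≤ k+l-3`,
`Q_{l-j} = Σ_{r=0}^{j} Σ_{σ(α)=j-r} λ_r C(s_r/s, α) G^{s_r - s|α|} Π_{i≥1} P_{k-i}^{α_i}`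
in the fraction field of `ℂ[x,y]`. -/
theorem jacDet_const_iff_integrated (P Q G : MvPolynomial (Fin 2) ℂ) (k l s : ℕ)
    (hP0 : eval (0 : Fin 2 → ℂ) P = 0) (hQ0 : eval (0 : Fin 2 → ℂ) Q = 0)
    (hdegP : P.totalDegree = k) (hdegQ : Q.totalDegree = l)
    (hk : 1 ≤ k) (hl : 1 ≤ l) (hkl : 1 < k * l)
    (hs : s = sVal (algebraMap (MvPolynomial (Fin 2) ℂ) FF (homogeneousComponent k P)))
    (hGhom : ∃ g : ℕ, G.IsHomogeneous g)
    (hGsimple : sVal (algebraMap (MvPolynomial (Fin 2) ℂ) FF G) = 1)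
    (hGs : G ^ s = homogeneousComponent k P) :
    (∃ c : ℂ, jacDet P Q = C c) ↔
      ∃! lam : Fin (k + l - 2) → ℂ,
        (∀ r : Fin (k + l - 2), lam r ≠ 0 → (k : ℤ) ∣ (s : ℤ) * ((l : ℤ) - ((r : ℕ) : ℤ))) ∧
        ∀ j : Fin (k + l - 2),
          algebraMap (MvPolynomial (Fin 2) ℂ) FF (hcomp Q ((l : ℤ) - ((j : ℕ) : ℤ))) =
            ∑ r ∈ Finset.Iic j,
              ∑ᶠ a ∈ {a : ℕ+ →₀ ℕ | ssize a = (j : ℕ) - (r : ℕ)},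
                algebraMap (MvPolynomial (Fin 2) ℂ) FF (C (lam r)) *
                  ((mcoeff
                      (((if lam r = 0 then (0 : ℤ)
                          else (s : ℤ) * ((l : ℤ) - ((r : ℕ) : ℤ)) / (k : ℤ)) : ℚ) / (s : ℚ))
                      a : ℚ) : FF) *
                  (algebraMap (MvPolynomial (Fin 2) ℂ) FF G) ^
                    ((if lam r = 0 then (0 : ℤ)
                        else (s : ℤ) * ((l : ℤ) - ((r : ℕ) : ℤ)) / (k : ℤ))
                      - (s : ℤ) * (msize a : ℤ)) *
                  algebraMap (MvPolynomial (Fin 2) ℂ) FF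
                    (∏ i ∈ a.support, hcomp P ((k : ℤ) - ((i : ℕ) : ℤ)) ^ a i) := by
  rw [jacDet_const_iff_existsUnique_expansion P Q G k l s hdegP hdegQ hk hGhom hGsimple hGs]
  refine existsUnique_congr fun lam => and_congr_right fun hgood => forall_congr' fun j =>
    Eq.congr_right (Finset.sum_congr rfl fun r _ => finsum_congr fun a => finsum_congr fun _ => ?_)
  rw [expansionExponent_cast (by omega) (hgood r), expansionExponent, map_prod]
  simp only [map_pow]
  rfl
end

section
/- Let P, Q ∈ ℂ[x,y] with P(0) = Q(0) = 0, deg P = k ≥ 1, deg Q = l ≥ 1, k·l > 1, and suppose the Jacobian determinant D(P,Q) is a constant. Let s = s(P_k) and let G be a simple homogeneous polynomial with G^s = P_k. Then for every j with 0 ≤ j ≤ min(l−1, k+l−3), the homogeneous component Q_{l−j} of Q is determined by the homogeneous components of P up to the choice of the j+1 scalars λ_0,…,λ_j: explicitly, there exist unique λ_0, …, λ_j ∈ ℂ such that Q_{l−j'} = Σ_{r=0}^{j'} Σ_{α ∈ Γ, σ(α) = j' − r} λ_r · C(s_r/s, α) · G^{s_r − s|α|} · ∏_{i≥1} P_{k−i}^{α_i}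 in the fraction field of ℂ[x,y] for all 0 ≤ j' ≤ j, where s_r = s·(l−r)/k ∈ ℤ if λ_r ≠ 0 and s_r = 0 if λ_r = 0, and P_m = 0 for m < 0. -/
open MvPolynomial

/-- A derivation of a domain extends to its fraction field. -/
theorem exists_derivation_fractionField {R A K : Type*} [CommRing R] [CommRing A] [IsDomain A]
    [Field K] [Algebra R A] [Algebra A K] [Algebra R K] [IsScalarTower R A K] [IsFractionRing A K]
    (d : Derivation R A A) :
    ∃ D : Derivation R K K, ∀ a, D (algebraMap A K a) = algebraMap A K (d a) := by
  let f : A →+* TrivSqZeroExt K K :=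
    { toFun := fun a => .inl (algebraMap A K a) + .inr (algebraMap A K (d a))
      map_one' := by ext <;> simp
      map_zero' := by ext <;> simp
      map_add' := fun a b => by ext <;> simp [Algebra.smul_def]
      map_mul' := fun a b => by
        ext <;> simp only [TrivSqZeroExt.fst_add, TrivSqZeroExt.snd_add, TrivSqZeroExt.fst_mul,
          TrivSqZeroExt.snd_mul, TrivSqZeroExt.fst_inl, TrivSqZeroExt.snd_inl,
          TrivSqZeroExt.fst_inr, TrivSqZeroExt.snd_inr,
          map_mul, map_add, d.leibniz, smul_eq_mul, MulOpposite.smul_eq_mul_unop,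
          MulOpposite.unop_op] <;> ring }
  have hfst : ∀ a, (f a).fst = algebraMap A K a := fun a => by simp [f]
  have hsnd : ∀ a, (f a).snd = algebraMap A K (d a) := fun a => by
    change (TrivSqZeroExt.inl _ + TrivSqZeroExt.inr _ : TrivSqZeroExt K K).snd = _
    rw [TrivSqZeroExt.snd_add, TrivSqZeroExt.snd_inl, TrivSqZeroExt.snd_inr, zero_add]
  have hunit : ∀ y : nonZeroDivisors A, IsUnit (f y) := fun y => by
    rw [TrivSqZeroExt.isUnit_iff_isUnit_fst, hfst]
    exact IsLocalization.map_units K y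
  let L : K →+* TrivSqZeroExt K K := IsLocalization.lift hunit
  have hL : ∀ a, L (algebraMap A K a) = f a := fun a => IsLocalization.lift_eq hunit a
  have hid : (TrivSqZeroExt.fstHom ℤ K K : TrivSqZeroExt K K →+* K).comp L = RingHom.id K := by
    apply IsLocalization.ringHom_ext (nonZeroDivisors A)
    ext a
    simp only [RingHom.comp_apply, hL]
    exact hfst a
  have hLfst : ∀ z, (L z).fst = z := fun z => congrArg (fun g : K →+* K => g z) hid
  have hLmul : ∀ a b, (L (a * b)).snd = a * (L b).snd + b * (L a).snd := fun a b => by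
    rw [map_mul, TrivSqZeroExt.snd_mul, hLfst, hLfst]
    simp [mul_comm]
  refine ⟨Derivation.mk'
    { toFun := fun z => (L z).snd
      map_add' := fun a b => by simp
      map_smul' := fun r z => ?_ } (fun a b => by simpa using hLmul a b), fun a => ?_⟩
  · rw [Algebra.smul_def, hLmul, IsScalarTower.algebraMap_apply R A K, hL, hsnd]
    simp [Algebra.smul_def, IsScalarTower.algebraMap_apply R A K]
  · change (L (algebraMap A K a)).snd = _
    rw [hL, hsnd]

theorem Derivation.map_ratCast {R K : Type*} [CommRing R] [Field K] [Algebra R K]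
    (D : Derivation R K K) (q : ℚ) : D (q : K) = 0 := by
  rw [Rat.cast_def, D.leibniz_div]
  simp

theorem Derivation.leibniz_finset_prod_pow {R K ι : Type*} [CommRing R] [Field K] [Algebra R K]
    [DecidableEq ι] (D : Derivation R K K) (t : Finset ι) (f : ι → K) (n : ι → ℕ) :
    D (∏ i ∈ t, f i ^ n i) =
      ∑ i ∈ t, (n i : K) * (f i ^ (n i - 1) * ∏ j ∈ t.erase i, f j ^ n j) * D (f i) := by
  induction t using Finset.induction_on with
  | empty => simp
  | insert a t ha ih =>
    rw [Finset.prod_insert ha, D.leibniz, ih, Finset.sum_insert ha, Finset.erase_insert ha,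
      D.leibniz_pow, smul_eq_mul, smul_eq_mul, Finset.mul_sum, add_comm]
    congr 1
    · simp; ring
    · refine Finset.sum_congr rfl fun i hi => ?_
      have hia : a ≠ i := fun h => ha (h ▸ hi)
      rw [Finset.erase_insert_of_ne hia,
        Finset.prod_insert (fun h => ha (Finset.mem_of_mem_erase h))]
      ring

theorem Derivation.leibniz_finsupp_prod_pow {R K ι : Type*} [CommRing R] [Field K] [Algebra R K]
    [DecidableEq ι] (D : Derivation R K K) (f : ι → K) (a : ι →₀ ℕ) :
    D (a.prod fun i n => f i ^ n) =
      ∑ i ∈ a.support,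
        (a i : K) * ((a - Finsupp.single i 1).prod fun i n => f i ^ n) * D (f i) := by
  rw [Finsupp.prod, D.leibniz_finset_prod_pow]
  refine Finset.sum_congr rfl fun i hi => ?_
  congr 2
  rw [Finsupp.prod_of_support_subset (s := a.support) _ (Finsupp.support_mono tsub_le_self) _
    (by simp), ← Finset.mul_prod_erase _ _ hi]
  congr 1
  · simp
  · refine Finset.prod_congr rfl fun j hj => ?_
    simp [(Finset.ne_of_mem_erase hj).symm]

theorem msize_add_single (b : ℕ+ →₀ ℕ) (i : ℕ+) :
    msize (b + Finsupp.single i 1) = msize b + 1 := by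
  unfold msize
  rw [Finsupp.sum_add_index' (by simp) (by simp)]
  simp

theorem ssize_add_single (b : ℕ+ →₀ ℕ) (i : ℕ+) :
    ssize (b + Finsupp.single i 1) = ssize b + i := by
  unfold ssize
  rw [Finsupp.sum_add_index' (by simp) (by intros; ring)]
  simp

theorem gfact_add_single (b : ℕ+ →₀ ℕ) (i : ℕ+) :
    gfact (b + Finsupp.single i 1) = (b i + 1) * gfact b := by
  classical
  unfold gfact
  rw [Finsupp.prod_of_support_subset (s := insert i b.support) b (Finset.subset_insert _ _) _
    (by simp), Finsupp.prod_of_support_subset (s := insert i b.support) (b + _) _ _ (by simp),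
    ← Finset.mul_prod_erase _ _ (Finset.mem_insert_self _ _),
    ← Finset.mul_prod_erase _ _ (Finset.mem_insert_self _ _), ← mul_assoc]
  · congr 1
    · simp [Nat.factorial_succ]
    · refine Finset.prod_congr rfl fun j hj => ?_
      simp [(Finset.ne_of_mem_erase hj).symm]
  · intro j hj
    by_cases h : j = i
    · simp [h]
    · simp only [Finsupp.mem_support_iff, Finsupp.add_apply, Finsupp.single_apply,
        if_neg (Ne.symm h), add_zero] at hj
      simp [hj]

theorem gfact_ne_zero (a : ℕ+ →₀ ℕ) : (gfact a : ℚ) ≠ 0 := by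
  simp [gfact, Finsupp.prod, Finset.prod_eq_zero_iff, Nat.factorial_ne_zero]

theorem mcoeff_mul_sub_msize (t : ℚ) (a : ℕ+ →₀ ℕ) :
    mcoeff t a * (t - msize a) = t * mcoeff (t - 1) a := by
  unfold mcoeff
  rw [div_mul_eq_mul_div, ← descPochhammer_succ_eval, descPochhammer_succ_left]
  simp [mul_div_assoc]

theorem mcoeff_add_single (t : ℚ) (b : ℕ+ →₀ ℕ) (i : ℕ+) :
    mcoeff t (b + Finsupp.single i 1) * (b i + 1) = t * mcoeff (t - 1) b := by
  unfold mcoeff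
  rw [msize_add_single, gfact_add_single, descPochhammer_succ_left]
  have h1 := gfact_ne_zero b
  have h2 : (b i + 1 : ℚ) ≠ 0 := by positivity
  simp
  field_simp

theorem le_ssize (a : ℕ+ →₀ ℕ) (i : ℕ+) (hi : i ∈ a.support) : (i : ℕ) * a i ≤ ssize a :=
  Finset.single_le_sum (f := fun i : ℕ+ => (i : ℕ) * a i) (fun _ _ => Nat.zero_le _) hi

theorem finite_ssize_eq (n : ℕ) : {a : ℕ+ →₀ ℕ | ssize a = n}.Finite := by
  classical
  refine (Finset.finite_toSet (Finset.finsupp (Finset.Icc 1 n.succPNat)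
    (fun _ => Finset.range (n + 1)))).subset fun a (ha : ssize a = n) => ?_
  have hle : ∀ i, i ∈ a.support → (i : ℕ) ≤ n ∧ a i ≤ n := fun i hi => by
    have h := le_ssize a i hi
    have h1 : 1 ≤ a i := Nat.one_le_iff_ne_zero.2 (Finsupp.mem_support_iff.1 hi)
    have h2 : 1 ≤ (i : ℕ) := i.pos
    rw [ha] at h
    exact ⟨by nlinarith, by nlinarith⟩
  rw [Finset.mem_coe, Finset.mem_finsupp_iff]
  refine ⟨fun i hi => ?_, fun i _ => ?_⟩
  · rw [Finset.mem_Icc]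
    refine ⟨one_le, ?_⟩
    rw [← PNat.coe_le_coe, Nat.succPNat_coe]
    exact (hle i hi).1.trans (Nat.le_succ n)
  · rw [Finset.mem_range, Nat.lt_succ_iff]
    by_cases h : i ∈ a.support
    · exact (hle i h).2
    · simp [Finsupp.notMem_support_iff.1 h]

/-- The finite set of multi-indices of size `n`. -/
noncomputable def sizeFinset (n : ℕ) : Finset (ℕ+ →₀ ℕ) := (finite_ssize_eq n).toFinset

theorem mem_sizeFinset {n : ℕ} {a : ℕ+ →₀ ℕ} : a ∈ sizeFinset n ↔ ssize a = n := by
  simp [sizeFinset]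

theorem sizeFinset_zero : sizeFinset 0 = {0} := by
  ext a
  rw [mem_sizeFinset, Finset.mem_singleton]
  refine ⟨fun h => ?_, fun h => by simp [h, ssize]⟩
  ext i
  by_contra hi
  have h1 := le_ssize a i (Finsupp.mem_support_iff.2 hi)
  have h2 : 0 < (i : ℕ) * a i := Nat.mul_pos i.pos (Nat.pos_of_ne_zero hi)
  omega

theorem sum_sizeFinset_sum_support {K : Type*} [Field K] (n : ℕ) (F : (ℕ+ →₀ ℕ) → K) (d : ℕ → K) :
    ∑ a ∈ sizeFinset n, ∑ i ∈ a.support, F (a - Finsupp.single i 1) * d i =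
      ∑ i ∈ Finset.range n, ∑ b ∈ sizeFinset (n - (i + 1)), F b * d (i + 1) := by
  rw [Finset.sum_sigma', Finset.sum_sigma']
  refine Finset.sum_bij' (fun x _ => ⟨x.2.natPred, x.1 - Finsupp.single x.2 1⟩)
    (fun y _ => ⟨y.2 + Finsupp.single y.1.succPNat 1, y.1.succPNat⟩) ?_ ?_ ?_ ?_ ?_
  · rintro ⟨a, i⟩ h
    simp only [Finset.mem_sigma, mem_sizeFinset] at h
    have hi : Finsupp.single i 1 ≤ a := by
      simpa [Nat.one_le_iff_ne_zero] using h.2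
    have h1 := ssize_add_single (a - Finsupp.single i 1) i
    rw [tsub_add_cancel_of_le hi, h.1] at h1
    have h2 : i.natPred + 1 = (i : ℕ) := PNat.natPred_add_one i
    simp only [Finset.mem_sigma, mem_sizeFinset, Finset.mem_range]
    omega
  · rintro ⟨i, b⟩ h
    simp only [Finset.mem_sigma, mem_sizeFinset, Finset.mem_range] at h
    simp only [Finset.mem_sigma, mem_sizeFinset, ssize_add_single, Nat.succPNat_coe]
    refine ⟨by omega, by simp⟩
  · rintro ⟨a, i⟩ h
    simp only [Finset.mem_sigma, mem_sizeFinset] at h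
    have hi : Finsupp.single i 1 ≤ a := by
      simpa [Nat.one_le_iff_ne_zero] using h.2
    simp [tsub_add_cancel_of_le hi]
  · rintro ⟨i, b⟩ h
    simp
  · rintro ⟨a, i⟩ h
    simp

section PowerComponents

variable {R K : Type*} [CommRing R] [Field K] [Algebra R K]

/-- The summand of index `a` in the expansion of the power `(∑ i, p i) ^ (m / s)`, where
`p 0 = G ^ s`. -/
noncomputable def powTerm (G : K) (s : ℕ) (p : ℕ → K) (m : ℤ) (a : ℕ+ →₀ ℕ) : K :=
  ((mcoeff ((m : ℚ) / s) a : ℚ) : K) * G ^ (m - s * (msize a : ℤ)) * a.prod fun i n => p i ^ n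

/-- The component of index `n` in the expansion of the power `(∑ i, p i) ^ (m / s)`, where
`p 0 = G ^ s`. -/
noncomputable def powComponent (G : K) (s : ℕ) (p : ℕ → K) (m : ℤ) (n : ℕ) : K :=
  ∑ a ∈ sizeFinset n, powTerm G s p m a

theorem powComponent_zero (G : K) (s : ℕ) (p : ℕ → K) (m : ℤ) :
    powComponent G s p m 0 = G ^ m := by
  simp [powComponent, sizeFinset_zero, powTerm, mcoeff, msize, gfact]

variable [CharZero K]

theorem Derivation.powTerm_eq (D : Derivation R K K) {G : K} {s : ℕ} (hG : G ≠ 0) (hs : s ≠ 0)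
    {p : ℕ → K} (hp : p 0 = G ^ s) (m : ℤ) (a : ℕ+ →₀ ℕ) :
    D (powTerm G s p m a) = ((m / s : ℚ) : K) * (powTerm G s p (m - s) a * D (p 0) +
      ∑ i ∈ a.support, powTerm G s p (m - s) (a - Finsupp.single i 1) * D (p i)) := by
  classical
  have hsQ : (s : ℚ) ≠ 0 := by exact_mod_cast hs
  have hsK : (s : K) ≠ 0 := by exact_mod_cast hs
  have ht : ((m - s : ℤ) : ℚ) / s = m / s - 1 := by push_cast; field_simp
  unfold powTerm
  rw [ht, D.leibniz, D.leibniz, D.map_ratCast, D.leibniz_zpow, D.leibniz_finsupp_prod_pow, hp,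
    D.leibniz_pow]
  simp only [smul_eq_mul, nsmul_eq_mul, zsmul_eq_mul, mul_zero, add_zero]
  rw [add_comm, mul_add, Finset.mul_sum, Finset.mul_sum]
  congr 1
  · have h1 : ((mcoeff ((m : ℚ) / s) a : ℚ) : K) * (m - s * msize a) =
        (m / s : ℚ) * (mcoeff ((m : ℚ) / s - 1) a : ℚ) * s := by
      have h := mcoeff_mul_sub_msize ((m : ℚ) / s) a
      have h' : mcoeff ((m : ℚ) / s) a * (m - s * msize a) =
          (m / s : ℚ) * (mcoeff ((m : ℚ) / s - 1) a : ℚ) * s := by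
        rw [← h]; field_simp
      exact_mod_cast congrArg (fun q : ℚ => (q : K)) h'
    have h2 : G ^ (m - s - s * (msize a : ℤ)) * G ^ (s - 1) = G ^ (m - s * (msize a : ℤ) - 1) := by
      rw [← zpow_natCast, ← zpow_add₀ hG, Nat.cast_sub (Nat.one_le_iff_ne_zero.2 hs)]
      congr 1
      push_cast
      ring
    rw [← h2]
    push_cast at h1 ⊢
    linear_combination (G ^ (m - s - s * (msize a : ℤ)) * G ^ (s - 1) *
      (a.prod fun i n => p i ^ n) * D G) * h1
  · refine Finset.sum_congr rfl fun i hi => ?_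
    have hi' : Finsupp.single i 1 ≤ a := by
      simpa [Nat.one_le_iff_ne_zero] using hi
    obtain ⟨b, rfl⟩ : ∃ b, a = b + Finsupp.single i 1 :=
      ⟨a - Finsupp.single i 1, (tsub_add_cancel_of_le hi').symm⟩
    have h1 : ((mcoeff ((m : ℚ) / s) (b + Finsupp.single i 1) : ℚ) : K) * (b i + 1) =
        (m / s : ℚ) * (mcoeff ((m : ℚ) / s - 1) b : ℚ) := by
      exact_mod_cast congrArg (fun q : ℚ => (q : K)) (mcoeff_add_single ((m : ℚ) / s) b i)
    have h2 : m - s * ((msize b + 1 : ℕ) : ℤ) = m - s - s * (msize b : ℤ) := by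
      push_cast; ring
    rw [msize_add_single, add_tsub_cancel_right, h2]
    simp only [Finsupp.add_apply, Finsupp.single_eq_same, Nat.cast_add, Nat.cast_one]
    linear_combination (G ^ (m - s - s * (msize b : ℤ)) *
      (b.prod fun i n => p i ^ n) * D (p i)) * h1

theorem Derivation.powComponent_eq (D : Derivation R K K) {G : K} {s : ℕ} (hG : G ≠ 0)
    (hs : s ≠ 0) {p : ℕ → K} (hp : p 0 = G ^ s) (m : ℤ) (n : ℕ) :
    D (powComponent G s p m n) = ((m / s : ℚ) : K) *
      ∑ i ∈ Finset.range (n + 1), powComponent G s p (m - s) (n - i) * D (p i) := by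
  unfold powComponent
  rw [map_sum, Finset.sum_congr rfl fun a _ => D.powTerm_eq hG hs hp m a, ← Finset.mul_sum,
    Finset.sum_add_distrib,
    sum_sizeFinset_sum_support n (powTerm G s p (m - s)) (fun i => D (p i)),
    Finset.sum_range_succ', add_comm]
  simp only [Finset.sum_mul, Nat.sub_zero]

/-- The Jacobian determinant of `∑ i, p i` with each of its powers vanishes, componentwise. -/
theorem sum_jacobian_powComponent_eq_zero (D D' : Derivation R K K) {G : K} {s : ℕ} (hG : G ≠ 0)
    (hs : s ≠ 0) {p : ℕ → K} (hp : p 0 = G ^ s) (m : ℤ) (n : ℕ) :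
    ∑ i ∈ Finset.range (n + 1), (D (p i) * D' (powComponent G s p m (n - i)) -
      D' (p i) * D (powComponent G s p m (n - i))) = 0 := by
  have key : ∀ E E' : Derivation R K K,
      ∑ i ∈ Finset.range (n + 1), E (p i) * E' (powComponent G s p m (n - i)) =
        ((m / s : ℚ) : K) * ∑ x ∈ Finset.HasAntidiagonal.antidiagonal n,
          ∑ y ∈ Finset.HasAntidiagonal.antidiagonal x.2,
          powComponent G s p (m - s) y.2 * E (p x.1) * E' (p y.1) := by
    intro E E'
    rw [Finset.Nat.sum_antidiagonal_eq_sum_range_succ_mk, Finset.mul_sum]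
    refine Finset.sum_congr rfl fun i _ => ?_
    rw [E'.powComponent_eq hG hs hp, Finset.Nat.sum_antidiagonal_eq_sum_range_succ_mk,
      mul_left_comm, Finset.mul_sum]
    congr 1
    exact Finset.sum_congr rfl fun j _ => by ring
  rw [Finset.sum_sub_distrib, key D D', key D' D, ← mul_sub, sub_eq_zero.2, mul_zero]
  rw [Finset.sum_sigma', Finset.sum_sigma']
  refine Finset.sum_bij' (fun x _ => ⟨(x.2.1, x.1.1 + x.2.2), (x.1.1, x.2.2)⟩)
    (fun x _ => ⟨(x.2.1, x.1.1 + x.2.2), (x.1.1, x.2.2)⟩) ?_ ?_ ?_ ?_ ?_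
  · rintro ⟨⟨a, b⟩, ⟨c, e⟩⟩ h
    simp only [Finset.mem_sigma, Finset.HasAntidiagonal.mem_antidiagonal] at h ⊢
    exact ⟨by omega, trivial⟩
  · rintro ⟨⟨a, b⟩, ⟨c, e⟩⟩ h
    simp only [Finset.mem_sigma, Finset.HasAntidiagonal.mem_antidiagonal] at h ⊢
    exact ⟨by omega, trivial⟩
  · rintro ⟨⟨a, b⟩, ⟨c, e⟩⟩ h
    simp only [Finset.mem_sigma, Finset.HasAntidiagonal.mem_antidiagonal] at h
    obtain ⟨h1, rfl⟩ := h
    rfl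
  · rintro ⟨⟨a, b⟩, ⟨c, e⟩⟩ h
    simp only [Finset.mem_sigma, Finset.HasAntidiagonal.mem_antidiagonal] at h
    obtain ⟨h1, rfl⟩ := h
    rfl
  · rintro ⟨⟨a, b⟩, ⟨c, e⟩⟩ h
    ring

end PowerComponents

theorem totalDegree_pderiv_le {σ R : Type*} [CommSemiring R] (i : σ) (a : MvPolynomial σ R) :
    (pderiv i a).totalDegree ≤ a.totalDegree - 1 := by
  refine Finset.sup_le fun m hm => ?_
  have h : m + Finsupp.single i 1 ∈ a.support := by
    rw [mem_support_iff] at hm ⊢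
    rw [coeff_pderiv] at hm
    exact left_ne_zero_of_mul hm
  have h1 := le_totalDegree h
  rw [Finsupp.sum_add_index' (by simp) (by simp), Finsupp.sum_single_index rfl] at h1
  omega

theorem pderiv_eq_zero_of_dvd_s13 {σ R : Type*} [CommRing R] [IsDomain R] {i : σ}
    {a : MvPolynomial σ R} (h : a ∣ pderiv i a) : pderiv i a = 0 := by
  by_contra h0
  have h1 := totalDegree_le_of_dvd_of_isDomain h h0
  have h2 := totalDegree_pderiv_le i a
  have h3 : a.totalDegree = 0 := by omega
  rw [totalDegree_eq_zero_iff_eq_C] at h3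
  exact h0 (by rw [h3, pderiv_C])

theorem eq_C_of_pderiv_eq_zero_s13 {σ R : Type*} [CommRing R] [IsDomain R] [CharZero R]
    {a : MvPolynomial σ R} (h : ∀ i, pderiv i a = 0) : a = C (coeff 0 a) := by
  classical
  ext m
  rw [coeff_C]
  split_ifs with hm
  · rw [hm]
  · obtain ⟨i, hi⟩ := Finsupp.ne_iff.1 (Ne.symm hm)
    have h1 := coeff_pderiv (i := i) a (m - Finsupp.single i 1)
    have hi' : Finsupp.single i 1 ≤ m := by
      simpa [Nat.one_le_iff_ne_zero] using hi
    rw [h i, coeff_zero, tsub_add_cancel_of_le hi'] at h1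
    exact (mul_eq_zero.1 h1.symm).resolve_right (Nat.cast_add_one_ne_zero _)

/-- In characteristic zero, an element of the fraction field killed by all partial derivatives is
a constant. -/
theorem exists_eq_algebraMap_C_of_forall_derivation_eq_zero {σ k K : Type*} [Field k] [CharZero k]
    [Field K] [Algebra (MvPolynomial σ k) K] [IsFractionRing (MvPolynomial σ k) K] [Algebra k K]
    (D : σ → Derivation k K K)
    (hD : ∀ i (a : MvPolynomial σ k), D i (algebraMap _ K a) = algebraMap _ K (pderiv i a)) {z : K}
    (hz : ∀ i, D i z = 0) : ∃ c : k, z = algebraMap (MvPolynomial σ k) K (C c) := by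
  obtain ⟨a, b, hab, rfl⟩ := IsFractionRing.exists_reduced_fraction (A := MvPolynomial σ k) z
  have hb0 : algebraMap (MvPolynomial σ k) K b ≠ 0 :=
    IsFractionRing.to_map_ne_zero_of_mem_nonZeroDivisors b.2
  have key : ∀ i, b * pderiv i a = a * pderiv i (b : MvPolynomial σ k) := fun i => by
    have h := hz i
    rw [IsFractionRing.mk'_eq_div, Derivation.leibniz_div, hD, hD, smul_eq_zero, sub_eq_zero] at h
    have h' := h.resolve_left (by simp [hb0])
    simp only [smul_eq_mul, ← map_mul] at h'
    exact IsFractionRing.injective _ K h'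
  have ha : ∀ i, pderiv i a = 0 := fun i => pderiv_eq_zero_of_dvd_s13
    (hab.dvd_of_dvd_mul_left ⟨_, key i⟩)
  have hb : ∀ i, pderiv i (b : MvPolynomial σ k) = 0 := fun i => pderiv_eq_zero_of_dvd_s13
    (hab.symm.dvd_of_dvd_mul_left ⟨_, (key i).symm⟩)
  have hac := eq_C_of_pderiv_eq_zero_s13 ha
  have hbc := eq_C_of_pderiv_eq_zero_s13 hb
  have hc : coeff 0 (b : MvPolynomial σ k) ≠ 0 := fun h => hb0 (by rw [hbc, h, C_0, map_zero])
  refine ⟨coeff 0 a / coeff 0 (b : MvPolynomial σ k), ?_⟩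
  rw [IsFractionRing.mk'_eq_div, div_eq_iff hb0, ← map_mul]
  nth_rewrite 2 [hbc]
  rw [← C_mul, div_mul_cancel₀ _ hc, ← hac]

section Eigen

variable {R K : Type*} [CommRing R] [Field K] [Algebra R K] {D : Derivation R K K}

theorem Derivation.eigen_mul {c d x y : K} (hx : D x = c * x) (hy : D y = d * y) :
    D (x * y) = (c + d) * (x * y) := by
  rw [D.leibniz, hx, hy, smul_eq_mul, smul_eq_mul]
  ring

theorem Derivation.eigen_zpow {c x : K} (hx0 : x ≠ 0) (hx : D x = c * x) (n : ℤ) :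
    D (x ^ n) = (n * c) * x ^ n := by
  rw [D.leibniz_zpow, hx, zpow_sub_one₀ hx0, smul_eq_mul, zsmul_eq_mul]
  field_simp

theorem Derivation.eigen_pow {c x : K} (hx : D x = c * x) (n : ℕ) :
    D (x ^ n) = (n * c) * x ^ n := by
  rcases n with _ | n
  · simp
  · rw [D.leibniz_pow, hx, smul_eq_mul, nsmul_eq_mul, Nat.add_sub_cancel]
    ring

theorem Derivation.eigen_prod {ι : Type*} (t : Finset ι) (f c : ι → K)
    (h : ∀ i ∈ t, D (f i) = c i * f i) : D (∏ i ∈ t, f i) = (∑ i ∈ t, c i) * ∏ i ∈ t, f i := by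
  classical
  induction t using Finset.induction_on with
  | empty => simp
  | insert a t ha ih =>
    rw [Finset.prod_insert ha, Finset.sum_insert ha]
    exact D.eigen_mul (h a (Finset.mem_insert_self a t))
      (ih fun i hi => h i (Finset.mem_insert_of_mem hi))

theorem Derivation.eigen_powComponent {G : K} (hG : G ≠ 0) {s g k : ℕ} (hgs : g * s = k)
    {p : ℕ → K} (hEG : D G = g * G) (hEp : ∀ i, D (p i) = (k - i) * p i) (m : ℤ) (n : ℕ) :
    D (powComponent G s p m n) = (g * m - n) * powComponent G s p m n := by
  unfold powComponent
  rw [map_sum, Finset.mul_sum]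
  refine Finset.sum_congr rfl fun a ha => ?_
  rw [mem_sizeFinset] at ha
  unfold powTerm Finsupp.prod
  rw [D.eigen_mul (D.eigen_mul (c := 0) (by rw [D.map_ratCast, zero_mul])
    (D.eigen_zpow hG hEG _)) (D.eigen_prod a.support (fun i => p i ^ a i)
      (fun i => a i * (k - (i : ℕ))) fun i _ => D.eigen_pow (hEp i) (a i))]
  congr 1
  have h : ∑ i ∈ a.support, (a i : K) * (k - (i : ℕ)) = k * msize a - ssize a := by
    simp only [msize, ssize, Finsupp.sum, Nat.cast_sum, Nat.cast_mul, Finset.mul_sum,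
      ← Finset.sum_sub_distrib]
    exact Finset.sum_congr rfl fun i _ => by ring
  rw [h, ha, ← hgs]
  push_cast
  ring

end Eigen

/-- A rational function algebraically dependent on a simple one, both being homogeneous, is up to
a scalar a power of it. -/
theorem exists_eq_C_mul_zpow {Dx Dy : Derivation ℂ FF FF}
    (hDx : ∀ a : MvPolynomial (Fin 2) ℂ, Dx (algebraMap _ FF a) = algebraMap _ FF (pderiv 0 a))
    (hDy : ∀ a : MvPolynomial (Fin 2) ℂ, Dy (algebraMap _ FF a) = algebraMap _ FF (pderiv 1 a))
    {x y z w : FF} {g : ℕ} {d : ℤ} (hg : g ≠ 0) (hz : z ≠ 0) (hw : w ≠ 0) (hw1 : sVal w = 1)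
    (hEz : x * Dx z + y * Dy z = d * z) (hEw : x * Dx w + y * Dy w = g * w)
    (hD : Dx w * Dy z - Dy w * Dx z = 0) :
    ∃ (c : ℂ) (e : ℤ), d = g * e ∧ z = algebraMap (MvPolynomial (Fin 2) ℂ) FF (C c) * w ^ e := by
  obtain ⟨h, g', d', hh, hcop, hg', hd'⟩ := Int.exists_gcd_one' (m := (g : ℤ)) (n := d)
    (Int.gcd_pos_of_ne_zero_left _ (by exact_mod_cast hg))
  have hhFF : (h : FF) ≠ 0 := by exact_mod_cast hh.ne'
  have hgK : (g : FF) = g' * h := by exact_mod_cast congrArg (fun q : ℤ => (q : FF)) hg'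
  have hdK : (d : FF) = d' * h := by exact_mod_cast congrArg (fun q : ℤ => (q : FF)) hd'
  have hx : (g' : FF) * w * Dx z = d' * z * Dx w := by
    apply mul_left_cancel₀ hhFF
    rw [hgK] at hEw
    rw [hdK] at hEz
    linear_combination (-Dx z) * hEw + Dx w * hEz - y * hD
  have hy : (g' : FF) * w * Dy z = d' * z * Dy w := by
    apply mul_left_cancel₀ hhFF
    rw [hgK] at hEw
    rw [hdK] at hEz
    linear_combination (-Dy z) * hEw + Dy w * hEz + x * hD
  have hconst : ∀ D : Derivation ℂ FF FF, (g' : FF) * w * D z = d' * z * D w →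
      D (z ^ g' * w ^ (-d')) = 0 := fun D hD => by
    rw [D.leibniz, D.leibniz_zpow, D.leibniz_zpow, zpow_sub_one₀ hz, zpow_sub_one₀ hw]
    simp only [smul_eq_mul, zsmul_eq_mul]
    push_cast
    have : z ^ g' * z⁻¹ * w ^ (-d') * w⁻¹ * (g' * w * D z - d' * z * D w) = 0 := by
      rw [hD]; ring
    rw [← this]
    field_simp
    ring
  obtain ⟨c, hc⟩ := exists_eq_algebraMap_C_of_forall_derivation_eq_zero (σ := Fin 2) (k := ℂ)
    (K := FF) (z := z ^ g' * w ^ (-d')) ![Dx, Dy]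
    (fun i a => by fin_cases i; exacts [hDx a, hDy a])
    (fun i => by fin_cases i; exacts [hconst Dx hx, hconst Dy hy])
  have hzg : z ^ g' = algebraMap (MvPolynomial (Fin 2) ℂ) FF (C c) * w ^ d' := by
    rw [← hc, mul_assoc, ← zpow_add₀ hw, neg_add_cancel, zpow_zero, mul_one]
  have hg'pos : 0 < g' := by
    have : 0 < g' * (h : ℤ) := by rw [← hg']; exact_mod_cast Nat.pos_of_ne_zero hg
    exact pos_of_mul_pos_left this (by positivity)
  lift g' to ℕ using hg'pos.le
  have hg'pos' : 0 < g' := by exact_mod_cast hg'pos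
  obtain ⟨c₁, hc₁⟩ := IsAlgClosed.exists_pow_nat_eq c hg'pos'
  set κ := algebraMap (MvPolynomial (Fin 2) ℂ) FF (C c₁) with hκ
  have hκc : algebraMap (MvPolynomial (Fin 2) ℂ) FF (C c) = κ ^ g' := by
    rw [hκ, ← hc₁, map_pow, map_pow]
  have hκ0 : κ ≠ 0 := by
    rintro h0
    rw [hκc, h0, zero_pow hg'pos'.ne', zero_mul] at hzg
    exact zpow_ne_zero _ hz hzg
  have hbdd : BddAbove {m : ℕ | 1 ≤ m ∧ ∃ X : FF, w = X ^ m} := by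
    by_contra hb
    rw [sVal, Nat.sSup_of_not_bddAbove hb] at hw1
    omega
  have hbez := Int.isCoprime_iff_gcd_eq_one.2 hcop
  obtain ⟨u, v, huv⟩ := hbez
  have hwpow : w = (w ^ u * z ^ v * κ ^ (-v)) ^ g' := by
    have h1 : (w ^ u * z ^ v * κ ^ (-v)) ^ g' =
        w ^ (u * g') * (z ^ (g' : ℤ)) ^ v * (κ ^ g') ^ (-v) := by
      rw [mul_pow, mul_pow, ← zpow_natCast, ← zpow_natCast, ← zpow_natCast, ← zpow_natCast κ,
        ← zpow_mul, ← zpow_mul, ← zpow_mul, ← zpow_mul, ← zpow_mul, mul_comm v, mul_comm (-v)]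
    rw [h1, hzg, hκc, mul_zpow, mul_assoc, mul_right_comm ((κ ^ g') ^ v),
      ← zpow_add₀ (pow_ne_zero _ hκ0), add_neg_cancel, zpow_zero, one_mul, ← zpow_mul,
      ← zpow_add₀ hw, mul_comm d', huv, zpow_one]
  have hle : g' ≤ 1 := hw1 ▸ le_csSup hbdd ⟨hg'pos', _, hwpow⟩
  obtain rfl : g' = 1 := le_antisymm hle hg'pos'
  refine ⟨c, d', ?_, by simpa using hzg⟩
  rw [hg', hd']
  push_cast
  ring

theorem hcomp_natCast_sub {P : MvPolynomial (Fin 2) ℂ} {k i : ℕ} (h : i ≤ k) :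
    hcomp P ((k : ℤ) - (i : ℤ)) = homogeneousComponent (k - i) P := by
  rw [hcomp, if_pos (by omega)]
  congr 2
  omega

theorem hcomp_natCast_sub_of_lt {P : MvPolynomial (Fin 2) ℂ} {k i : ℕ} (h : k < i) :
    hcomp P ((k : ℤ) - (i : ℤ)) = 0 := by
  rw [hcomp, if_neg (by omega)]

theorem sum_hcomp (P : MvPolynomial (Fin 2) ℂ) {k N : ℕ} (hP : P.totalDegree = k) (hN : k < N) :
    ∑ i ∈ Finset.range N, hcomp P ((k : ℤ) - (i : ℤ)) = P := by
  rw [← Finset.sum_subset (Finset.range_mono (Nat.succ_le_of_lt hN)) fun i _ hi =>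
    hcomp_natCast_sub_of_lt (by simpa using hi)]
  conv_rhs => rw [← sum_homogeneousComponent P, hP, ← Finset.sum_range_reflect]
  refine Finset.sum_congr rfl fun i hi => ?_
  rw [hcomp_natCast_sub (Nat.lt_succ_iff.1 (Finset.mem_range.1 hi)), Nat.add_sub_cancel]

theorem jacDet_sum_sum {ι κ : Type*} (t : Finset ι) (u : Finset κ)
    (f : ι → MvPolynomial (Fin 2) ℂ) (h : κ → MvPolynomial (Fin 2) ℂ) :
    jacDet (∑ i ∈ t, f i) (∑ j ∈ u, h j) = ∑ i ∈ t, ∑ j ∈ u, jacDet (f i) (h j) := by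
  simp only [jacDet, map_sum, Finset.sum_mul_sum, Finset.sum_sub_distrib]

theorem pderiv_hcomp_eq_zero (P : MvPolynomial (Fin 2) ℂ) {k i : ℕ} (h : k ≤ i) (v : Fin 2) :
    pderiv v (hcomp P ((k : ℤ) - (i : ℤ))) = 0 := by
  rcases h.lt_or_eq with h | rfl
  · rw [hcomp_natCast_sub_of_lt h, map_zero]
  · rw [hcomp_natCast_sub le_rfl, Nat.sub_self, homogeneousComponent_zero, pderiv_C]

theorem homogeneousComponent_jacDet_hcomp (P Q : MvPolynomial (Fin 2) ℂ) {k l m n : ℕ}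
    (hmn : m + n + 2 = k + l) (i j : ℕ) :
    homogeneousComponent m (jacDet (hcomp P ((k : ℤ) - (i : ℤ))) (hcomp Q ((l : ℤ) - (j : ℤ)))) =
      if i + j = n then jacDet (hcomp P ((k : ℤ) - (i : ℤ))) (hcomp Q ((l : ℤ) - (j : ℤ)))
      else 0 := by
  rcases le_or_gt k i with hi | hi
  · simp [jacDet, pderiv_hcomp_eq_zero P hi]
  rcases le_or_gt l j with hj | hj
  · simp [jacDet, pderiv_hcomp_eq_zero Q hj]
  have hdeg : (jacDet (hcomp P ((k : ℤ) - (i : ℤ))) (hcomp Q ((l : ℤ) - (j : ℤ)))).IsHomogeneous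
      ((k - i - 1) + (l - j - 1)) := by
    rw [hcomp_natCast_sub hi.le, hcomp_natCast_sub hj.le]
    have hp := homogeneousComponent_isHomogeneous (k - i) P
    have hq := homogeneousComponent_isHomogeneous (l - j) Q
    exact (hp.pderiv.mul hq.pderiv).sub (hp.pderiv.mul hq.pderiv)
  rw [homogeneousComponent_of_mem hdeg]
  congr 1
  simp only [eq_iff_iff]
  omega

theorem sum_jacDet_hcomp_eq_zero {P Q : MvPolynomial (Fin 2) ℂ} {k l n : ℕ} {c : ℂ}
    (hP : P.totalDegree = k) (hQ : Q.totalDegree = l) (hc : jacDet P Q = C c)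
    (hn : n + 3 ≤ k + l) :
    ∑ i ∈ Finset.range (n + 1),
      jacDet (hcomp P ((k : ℤ) - (i : ℤ))) (hcomp Q ((l : ℤ) - ((n - i : ℕ) : ℤ))) = 0 := by
  obtain ⟨m, hm⟩ : ∃ m, m + 1 + n + 2 = k + l := ⟨k + l - n - 3, by omega⟩
  have h := congrArg (homogeneousComponent (m + 1)) hc
  rw [← sum_hcomp P hP (N := k + l + n + 1) (by omega),
    ← sum_hcomp Q hQ (N := k + l + n + 1) (by omega), jacDet_sum_sum,
    homogeneousComponent_of_mem (isHomogeneous_C _ c), if_neg (Nat.succ_ne_zero m)] at h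
  simp only [map_sum, homogeneousComponent_jacDet_hcomp P Q hm] at h
  have hinner : ∀ i ∈ Finset.range (k + l + n + 1), (∑ j ∈ Finset.range (k + l + n + 1),
      if i + j = n then jacDet (hcomp P ((k : ℤ) - (i : ℤ))) (hcomp Q ((l : ℤ) - (j : ℤ))) else 0) =
      if i < n + 1 then jacDet (hcomp P ((k : ℤ) - (i : ℤ))) (hcomp Q ((l : ℤ) - ((n - i : ℕ) : ℤ)))
      else 0 := fun i _ => by
    split_ifs with hi
    · rw [Finset.sum_eq_single_of_mem (n - i) (Finset.mem_range.2 (by omega))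
        fun j _ hj => if_neg (by omega), if_pos (by omega)]
    · exact Finset.sum_eq_zero fun j _ => if_neg (by omega)
  rw [Finset.sum_congr rfl hinner, ← Finset.sum_filter] at h
  rw [← h]
  refine Finset.sum_congr ?_ fun _ _ => rfl
  ext i
  simp only [Finset.mem_filter, Finset.mem_range]
  omega

theorem summand_eq_C_mul_powTerm (P : MvPolynomial (Fin 2) ℂ) (G : FF) {k l s r : ℕ} (hk : k ≠ 0)
    (c : ℂ) (hdvd : c ≠ 0 → (k : ℤ) ∣ (s : ℤ) * ((l : ℤ) - (r : ℤ))) (a : ℕ+ →₀ ℕ) :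
    algebraMap (MvPolynomial (Fin 2) ℂ) FF (C c) *
        ((mcoeff (((if c = 0 then (0 : ℤ) else (s : ℤ) * ((l : ℤ) - (r : ℤ)) / (k : ℤ)) : ℚ) /
          (s : ℚ)) a : ℚ) : FF) *
        G ^ ((if c = 0 then (0 : ℤ) else (s : ℤ) * ((l : ℤ) - (r : ℤ)) / (k : ℤ)) -
          (s : ℤ) * (msize a : ℤ)) *
        algebraMap (MvPolynomial (Fin 2) ℂ) FF
          (∏ i ∈ a.support, hcomp P ((k : ℤ) - ((i : ℕ) : ℤ)) ^ a i) =
      algebraMap (MvPolynomial (Fin 2) ℂ) FF (C c) *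
        powTerm G s (fun i => algebraMap (MvPolynomial (Fin 2) ℂ) FF (hcomp P ((k : ℤ) - (i : ℤ))))
          ((s : ℤ) * ((l : ℤ) - (r : ℤ)) / (k : ℤ)) a := by
  by_cases hc : c = 0
  · simp [hc]
  · have hcast : ((s : ℤ) : ℚ) * (((l : ℤ) : ℚ) - ((r : ℤ) : ℚ)) / ((k : ℤ) : ℚ) =
        (((s : ℤ) * ((l : ℤ) - (r : ℤ)) / (k : ℤ) : ℤ) : ℚ) := by
      rw [Int.cast_div (hdvd hc) (by exact_mod_cast hk)]
      push_cast
      rfl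
    rw [if_neg hc, if_neg hc, hcast, powTerm, Finsupp.prod, map_prod]
    simp only [map_pow, mul_assoc]

theorem finsum_ssize_eq_C_mul_powComponent (P : MvPolynomial (Fin 2) ℂ) (G : FF) {k l s r : ℕ}
    (hk : k ≠ 0) (c : ℂ) (hdvd : c ≠ 0 → (k : ℤ) ∣ (s : ℤ) * ((l : ℤ) - (r : ℤ))) (n : ℕ) :
    ∑ᶠ a ∈ {a : ℕ+ →₀ ℕ | ssize a = n}, algebraMap (MvPolynomial (Fin 2) ℂ) FF (C c) *
        ((mcoeff (((if c = 0 then (0 : ℤ) else (s : ℤ) * ((l : ℤ) - (r : ℤ)) / (k : ℤ)) : ℚ) /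
          (s : ℚ)) a : ℚ) : FF) *
        G ^ ((if c = 0 then (0 : ℤ) else (s : ℤ) * ((l : ℤ) - (r : ℤ)) / (k : ℤ)) -
          (s : ℤ) * (msize a : ℤ)) *
        algebraMap (MvPolynomial (Fin 2) ℂ) FF
          (∏ i ∈ a.support, hcomp P ((k : ℤ) - ((i : ℕ) : ℤ)) ^ a i) =
      algebraMap (MvPolynomial (Fin 2) ℂ) FF (C c) *
        powComponent G s
          (fun i => algebraMap (MvPolynomial (Fin 2) ℂ) FF (hcomp P ((k : ℤ) - (i : ℤ))))
          ((s : ℤ) * ((l : ℤ) - (r : ℤ)) / (k : ℤ)) n := by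
  rw [powComponent, Finset.mul_sum, finsum_mem_eq_finite_toFinset_sum _ (finite_ssize_eq n)]
  exact Finset.sum_congr rfl fun a _ => summand_eq_C_mul_powTerm P G hk c hdvd a

theorem sum_Iic_fin_eq_sum_range {M : Type*} [AddCommMonoid M] {j : ℕ} (i : Fin (j + 1))
    (f : ℕ → M) : ∑ r ∈ Finset.Iic i, f r = ∑ r ∈ Finset.range (i + 1), f r := by
  have h : Finset.range (i + 1) = (Finset.Iic i).map Fin.valEmbedding := by
    rw [Fin.map_valEmbedding_Iic, Nat.range_succ_eq_Iic]
  rw [h, Finset.sum_map]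
  rfl

/-- If the components of index less than `n` of `q` are combinations, with constant coefficients
`c r`, of shifted powers of `∑ i, p i`, and `p` and `q` have vanishing Jacobian up to order `n`,
then the defect of `q n` is algebraically dependent on `G`. -/
theorem jacobian_sub_sum_powComponent_eq_zero {R K : Type*} [CommRing R] [Field K] [Algebra R K]
    [CharZero K] (D D' : Derivation R K K) {G : K} {s : ℕ} (hG : G ≠ 0) (hs : s ≠ 0)
    {p q : ℕ → K} (hp : p 0 = G ^ s) (e : ℕ → ℤ) {c : ℕ → K} (hc : ∀ r, D (c r) = 0)
    (hc' : ∀ r, D' (c r) = 0) {n : ℕ}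
    (hq : ∀ i < n, q i = ∑ r ∈ Finset.range (i + 1), c r * powComponent G s p (e r) (i - r))
    (hJ : ∑ i ∈ Finset.range (n + 1), (D (p i) * D' (q (n - i)) - D' (p i) * D (q (n - i))) = 0) :
    D G * D' (q n - ∑ r ∈ Finset.range n, c r * powComponent G s p (e r) (n - r)) -
      D' G * D (q n - ∑ r ∈ Finset.range n, c r * powComponent G s p (e r) (n - r)) = 0 := by
  let F : ℕ → ℕ → K := fun r i => if r ≤ i then c r * powComponent G s p (e r) (i - r) else 0
  have hFsum : ∀ r ∈ Finset.range n, ∑ i ∈ Finset.range (n + 1),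
      (D (p i) * D' (F r (n - i)) - D' (p i) * D (F r (n - i))) = 0 := fun r hr => by
    have hr := Finset.mem_range.1 hr
    rw [← Finset.sum_subset (Finset.range_mono (show n - r + 1 ≤ n + 1 by omega))
      fun i hi hi' => ?_]
    · rw [← mul_zero (c r), ← sum_jacobian_powComponent_eq_zero D D' hG hs hp (e r) (n - r),
        Finset.mul_sum]
      refine Finset.sum_congr rfl fun i hi => ?_
      have hi := Finset.mem_range.1 hi
      simp only [F]
      rw [if_pos (by omega), Nat.sub_right_comm, D.leibniz, D'.leibniz, hc, hc']
      simp only [smul_eq_mul, mul_zero, add_zero]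
      ring
    · simp only [Finset.mem_range] at hi hi'
      simp only [F]
      rw [if_neg (by omega), map_zero, map_zero, mul_zero, mul_zero, sub_zero]
  have hFq : ∀ i < n, q i = ∑ r ∈ Finset.range n, F r i := fun i hi => by
    rw [hq i hi, ← Finset.sum_subset (Finset.range_mono (show i + 1 ≤ n by omega))
      fun r _ hr => if_neg (by simpa using hr)]
    exact Finset.sum_congr rfl fun r hr =>
      (if_pos (Nat.lt_succ_iff.1 (Finset.mem_range.1 hr))).symm
  have hFn : ∑ r ∈ Finset.range n, c r * powComponent G s p (e r) (n - r) =
      ∑ r ∈ Finset.range n, F r n :=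
    Finset.sum_congr rfl fun r hr => (if_pos (Finset.mem_range.1 hr).le).symm
  rw [hFn]
  have hdiff : ∑ i ∈ Finset.range (n + 1), (D (p i) * D' (q (n - i) - ∑ r ∈ Finset.range n,
      F r (n - i)) - D' (p i) * D (q (n - i) - ∑ r ∈ Finset.range n, F r (n - i))) = 0 := by
    rw [← hJ, ← sub_eq_zero, ← Finset.sum_sub_distrib, ← neg_eq_zero,
      ← Finset.sum_eq_zero hFsum, Finset.sum_comm, ← Finset.sum_neg_distrib]
    refine Finset.sum_congr rfl fun i _ => ?_
    rw [Finset.sum_sub_distrib, ← Finset.mul_sum, ← Finset.mul_sum, map_sub, map_sub, map_sum,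
      map_sum]
    ring
  rw [Finset.sum_range_succ', Finset.sum_eq_zero, zero_add] at hdiff
  · rw [Nat.sub_zero, hp, D.leibniz_pow, D'.leibniz_pow] at hdiff
    simp only [smul_eq_mul, nsmul_eq_mul] at hdiff
    have hs' : (s : K) * G ^ (s - 1) ≠ 0 :=
      mul_ne_zero (by exact_mod_cast hs) (pow_ne_zero _ hG)
    apply mul_left_cancel₀ hs'
    rw [mul_zero, ← hdiff]
    ring
  · intro i hi
    rw [hFq (n - (i + 1)) (by have := Finset.mem_range.1 hi; omega)]
    simp

theorem euler_of_isHomogeneous {Dx Dy : Derivation ℂ FF FF}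
    (hDx : ∀ a : MvPolynomial (Fin 2) ℂ, Dx (algebraMap _ FF a) = algebraMap _ FF (pderiv 0 a))
    (hDy : ∀ a : MvPolynomial (Fin 2) ℂ, Dy (algebraMap _ FF a) = algebraMap _ FF (pderiv 1 a))
    {a : MvPolynomial (Fin 2) ℂ} {n : ℕ} (ha : a.IsHomogeneous n) :
    algebraMap (MvPolynomial (Fin 2) ℂ) FF (X 0) * Dx (algebraMap _ FF a) +
      algebraMap (MvPolynomial (Fin 2) ℂ) FF (X 1) * Dy (algebraMap _ FF a) =
        n * algebraMap _ FF a := by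
  have h := congrArg (algebraMap _ FF) ha.sum_X_mul_pderiv
  rw [Fin.sum_univ_two] at h
  rw [hDx, hDy, ← map_mul, ← map_mul, ← map_add, h, nsmul_eq_mul, map_mul, map_natCast]

theorem sub_sum_powComponent_eq_C_mul_zpow {Dx Dy : Derivation ℂ FF FF}
    (hDx : ∀ a : MvPolynomial (Fin 2) ℂ, Dx (algebraMap _ FF a) = algebraMap _ FF (pderiv 0 a))
    (hDy : ∀ a : MvPolynomial (Fin 2) ℂ, Dy (algebraMap _ FF a) = algebraMap _ FF (pderiv 1 a))
    {G : FF} (hG : G ≠ 0) (hG1 : sVal G = 1) {g s k l : ℕ} (hk : k ≠ 0) (hgs : g * s = k)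
    {x y : FF} {p q : ℕ → FF} (hp : p 0 = G ^ s)
    (hEG : x * Dx G + y * Dy G = g * G)
    (hEp : ∀ i, x * Dx (p i) + y * Dy (p i) = (k - i) * p i)
    {n : ℕ} (hEq : x * Dx (q n) + y * Dy (q n) = (l - n) * q n)
    (hJ : ∑ i ∈ Finset.range (n + 1),
      (Dx (p i) * Dy (q (n - i)) - Dy (p i) * Dx (q (n - i))) = 0)
    {c : ℕ → ℂ} (hdvd : ∀ i < n, c i ≠ 0 → (k : ℤ) ∣ (s : ℤ) * ((l : ℤ) - (i : ℤ)))
    (hq : ∀ i < n, q i = ∑ r ∈ Finset.range (i + 1),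
      algebraMap (MvPolynomial (Fin 2) ℂ) FF (C (c r)) *
        powComponent G s p ((s : ℤ) * ((l : ℤ) - (r : ℤ)) / (k : ℤ)) (i - r)) :
    ∃ b : ℂ, (b ≠ 0 → (k : ℤ) ∣ (s : ℤ) * ((l : ℤ) - (n : ℤ))) ∧
      q n = (∑ r ∈ Finset.range n, algebraMap (MvPolynomial (Fin 2) ℂ) FF (C (c r)) *
        powComponent G s p ((s : ℤ) * ((l : ℤ) - (r : ℤ)) / (k : ℤ)) (n - r)) +
        algebraMap (MvPolynomial (Fin 2) ℂ) FF (C b) *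
          G ^ ((s : ℤ) * ((l : ℤ) - (n : ℤ)) / (k : ℤ)) := by
  have hs : s ≠ 0 := by rintro rfl; exact hk (by rw [← hgs, mul_zero])
  have hg : g ≠ 0 := by rintro rfl; exact hk (by rw [← hgs, zero_mul])
  have hcx : ∀ r, Dx (algebraMap (MvPolynomial (Fin 2) ℂ) FF (C (c r))) = 0 := fun r => by
    rw [hDx, pderiv_C, map_zero]
  have hcy : ∀ r, Dy (algebraMap (MvPolynomial (Fin 2) ℂ) FF (C (c r))) = 0 := fun r => by
    rw [hDy, pderiv_C, map_zero]
  have hjac := jacobian_sub_sum_powComponent_eq_zero Dx Dy hG hs hp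
    (fun r => (s : ℤ) * ((l : ℤ) - (r : ℤ)) / (k : ℤ)) hcx hcy hq hJ
  let E : Derivation ℂ FF FF := x • Dx + y • Dy
  have hE : ∀ a, E a = x * Dx a + y * Dy a := fun a => rfl
  have hEH : E (q n - ∑ r ∈ Finset.range n, algebraMap (MvPolynomial (Fin 2) ℂ) FF (C (c r)) *
      powComponent G s p ((s : ℤ) * ((l : ℤ) - (r : ℤ)) / (k : ℤ)) (n - r)) =
      (((l : ℤ) - (n : ℤ) : ℤ) : FF) *
        (q n - ∑ r ∈ Finset.range n, algebraMap (MvPolynomial (Fin 2) ℂ) FF (C (c r)) *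
          powComponent G s p ((s : ℤ) * ((l : ℤ) - (r : ℤ)) / (k : ℤ)) (n - r)) := by
    rw [map_sub, map_sum, mul_sub, Finset.mul_sum]
    congr 1
    · rw [hE, hEq]
      push_cast
      rfl
    refine Finset.sum_congr rfl fun r hr => ?_
    have hr := Finset.mem_range.1 hr
    by_cases hcr : c r = 0
    · simp [hcr]
    have hexp : (g : ℤ) * ((s : ℤ) * ((l : ℤ) - (r : ℤ)) / (k : ℤ)) = (l : ℤ) - (r : ℤ) := by
      apply mul_left_cancel₀ (show (s : ℤ) ≠ 0 by exact_mod_cast hs)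
      rw [← mul_assoc, mul_comm (s : ℤ) g,
        show (g : ℤ) * s = k by exact_mod_cast hgs, Int.mul_ediv_cancel' (hdvd r hr hcr)]
    have hexp' := congrArg (fun z : ℤ => (z : FF)) hexp
    push_cast at hexp'
    rw [E.eigen_mul (c := 0) (by rw [hE, hcx, hcy]; ring)
      (E.eigen_powComponent hG hgs ((hE G).trans hEG) (fun i => (hE _).trans (hEp i)) _ _),
      Nat.cast_sub hr.le]
    push_cast
    rw [hexp']
    ring
  set S := ∑ r ∈ Finset.range n, algebraMap (MvPolynomial (Fin 2) ℂ) FF (C (c r)) *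
    powComponent G s p ((s : ℤ) * ((l : ℤ) - (r : ℤ)) / (k : ℤ)) (n - r) with hS
  rcases eq_or_ne (q n - S) 0 with h0 | h0
  · exact ⟨0, by simp, by rw [sub_eq_zero.1 h0]; simp⟩
  obtain ⟨b, m, hm, hb⟩ := exists_eq_C_mul_zpow hDx hDy hg h0 hG hG1 ((hE _).symm.trans hEH) hEG
    hjac
  have hkm : (s : ℤ) * ((l : ℤ) - (n : ℤ)) = k * m := by
    rw [hm, ← hgs]
    push_cast
    ring
  refine ⟨b, fun _ => ⟨m, hkm⟩, ?_⟩
  rw [hkm, Int.mul_ediv_cancel_left _ (by exact_mod_cast hk), ← hb, add_sub_cancel]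

theorem exists_forall_lt_of_forall_update {α : Type*} {N : ℕ} (S : ℕ → (ℕ → α) → Prop) [Inhabited α]
    (hstep : ∀ n < N, ∀ c : ℕ → α, (∀ i < n, S i c) → ∃ b, S n (Function.update c n b))
    (hlocal : ∀ n c c', (∀ r ≤ n, c r = c' r) → S n c → S n c') :
    ∃ c : ℕ → α, ∀ i < N, S i c := by
  suffices h : ∀ n ≤ N, ∃ c : ℕ → α, ∀ i < n, S i c from h N le_rfl
  intro n
  induction n with
  | zero => exact fun _ => ⟨fun _ => default, fun i hi => absurd hi i.not_lt_zero⟩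
  | succ n ih =>
    intro hn
    obtain ⟨c, hc⟩ := ih (by omega)
    obtain ⟨b, hb⟩ := hstep n hn c hc
    refine ⟨Function.update c n b, fun i hi => ?_⟩
    rcases (Nat.lt_succ_iff.1 hi).lt_or_eq with h | rfl
    · exact hlocal i c _ (fun r hr => (Function.update_of_ne (by omega) _ _).symm) (hc i h)
    · exact hb

theorem homogeneousComponent_totalDegree_ne_zero {σ R : Type*} [CommSemiring R]
    {P : MvPolynomial σ R} {k : ℕ} (hP : P.totalDegree = k) (hk : k ≠ 0) :
    homogeneousComponent k P ≠ 0 := by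
  have hP0 : P ≠ 0 := by
    rintro rfl
    exact hk (by rw [← hP, totalDegree_zero])
  obtain ⟨m, hm, hmdeg⟩ := Finset.exists_mem_eq_sup P.support
    (support_nonempty.2 hP0) (fun m => m.degree)
  intro h0
  have h := congrArg (coeff m) h0
  rw [coeff_homogeneousComponent, if_pos, coeff_zero] at h
  · exact mem_support_iff.1 hm h
  · rw [← hmdeg, ← hP, totalDegree_eq]
    refine congrArg _ (funext fun m => ?_)
    simp [Finsupp.card_toMultiset, Finsupp.degree_apply, Finsupp.sum]

theorem hcomp_natCast_sub_zero (P : MvPolynomial (Fin 2) ℂ) (k : ℕ) :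
    hcomp P ((k : ℤ) - ((0 : ℕ) : ℤ)) = homogeneousComponent k P := by
  rw [hcomp_natCast_sub k.zero_le, Nat.sub_zero]

theorem euler_hcomp_natCast_sub {Dx Dy : Derivation ℂ FF FF}
    (hDx : ∀ a : MvPolynomial (Fin 2) ℂ, Dx (algebraMap _ FF a) = algebraMap _ FF (pderiv 0 a))
    (hDy : ∀ a : MvPolynomial (Fin 2) ℂ, Dy (algebraMap _ FF a) = algebraMap _ FF (pderiv 1 a))
    (P : MvPolynomial (Fin 2) ℂ) (k i : ℕ) :
    algebraMap (MvPolynomial (Fin 2) ℂ) FF (X 0) *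
        Dx (algebraMap _ FF (hcomp P ((k : ℤ) - (i : ℤ)))) +
      algebraMap (MvPolynomial (Fin 2) ℂ) FF (X 1) *
        Dy (algebraMap _ FF (hcomp P ((k : ℤ) - (i : ℤ)))) =
      (k - i) * algebraMap _ FF (hcomp P ((k : ℤ) - (i : ℤ))) := by
  rcases le_or_gt i k with hi | hi
  · rw [hcomp_natCast_sub hi, euler_of_isHomogeneous hDx hDy
      (homogeneousComponent_isHomogeneous (k - i) P), Nat.cast_sub hi]
  · simp [hcomp_natCast_sub_of_lt hi]

/-- The equations satisfied by the scalar `c n` in terms of `c 0, …, c (n - 1)`. -/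
def IsExpansionAt (G : FF) (k l s : ℕ) (p q : ℕ → FF) (n : ℕ) (c : ℕ → ℂ) : Prop :=
  (c n ≠ 0 → (k : ℤ) ∣ (s : ℤ) * ((l : ℤ) - (n : ℤ))) ∧
    q n = ∑ r ∈ Finset.range (n + 1), algebraMap (MvPolynomial (Fin 2) ℂ) FF (C (c r)) *
      powComponent G s p ((s : ℤ) * ((l : ℤ) - (r : ℤ)) / (k : ℤ)) (n - r)

theorem IsExpansionAt.congr {G : FF} {k l s : ℕ} {p q : ℕ → FF} {n : ℕ} {c c' : ℕ → ℂ}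
    (hcc' : ∀ r ≤ n, c r = c' r) (h : IsExpansionAt G k l s p q n c) :
    IsExpansionAt G k l s p q n c' := by
  refine ⟨by rw [← hcc' n le_rfl]; exact h.1, h.2.trans (Finset.sum_congr rfl fun r hr => ?_)⟩
  rw [hcc' r (Nat.lt_succ_iff.1 (Finset.mem_range.1 hr))]

theorem IsExpansionAt.eq {G : FF} (hG : G ≠ 0) {k l s : ℕ} {p q : ℕ → FF} {N : ℕ} {c c' : ℕ → ℂ}
    (h : ∀ n < N, IsExpansionAt G k l s p q n c) (h' : ∀ n < N, IsExpansionAt G k l s p q n c')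
    (n : ℕ) (hn : n < N) : c n = c' n := by
  induction n using Nat.strong_induction_on with
  | _ n ih =>
    have heq := (h n hn).2.symm.trans (h' n hn).2
    rw [Finset.sum_range_succ, Finset.sum_range_succ, Finset.sum_congr rfl fun r hr => by
      rw [ih r (Finset.mem_range.1 hr) ((Finset.mem_range.1 hr).trans hn)], add_right_inj,
      Nat.sub_self, powComponent_zero] at heq
    exact C_injective _ _ (IsFractionRing.injective (MvPolynomial (Fin 2) ℂ) FF
      (mul_right_cancel₀ (zpow_ne_zero _ hG) heq))

theorem exists_isExpansionAt {P Q G : MvPolynomial (Fin 2) ℂ} {g k l s : ℕ}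
    (hdegP : P.totalDegree = k) (hdegQ : Q.totalDegree = l) (hk : k ≠ 0) {c₀ : ℂ}
    (hconst : jacDet P Q = C c₀) (hGhom : G.IsHomogeneous g) (hG : G ≠ 0) (hgs : g * s = k)
    (hGsimple : sVal (algebraMap (MvPolynomial (Fin 2) ℂ) FF G) = 1)
    (hGs : G ^ s = homogeneousComponent k P) {N : ℕ} (hN : N + 2 ≤ k + l) :
    ∃ c : ℕ → ℂ, ∀ n < N, IsExpansionAt (algebraMap _ FF G) k l s
      (fun i => algebraMap (MvPolynomial (Fin 2) ℂ) FF (hcomp P ((k : ℤ) - (i : ℤ))))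
      (fun i => algebraMap (MvPolynomial (Fin 2) ℂ) FF (hcomp Q ((l : ℤ) - (i : ℤ)))) n c := by
  obtain ⟨Dx, hDx⟩ := exists_derivation_fractionField (K := FF)
    (pderiv (0 : Fin 2) : Derivation ℂ (MvPolynomial (Fin 2) ℂ) (MvPolynomial (Fin 2) ℂ))
  obtain ⟨Dy, hDy⟩ := exists_derivation_fractionField (K := FF)
    (pderiv (1 : Fin 2) : Derivation ℂ (MvPolynomial (Fin 2) ℂ) (MvPolynomial (Fin 2) ℂ))
  have hGF : algebraMap (MvPolynomial (Fin 2) ℂ) FF G ≠ 0 := fun h => hG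
    (IsFractionRing.injective (MvPolynomial (Fin 2) ℂ) FF (h.trans (map_zero _).symm))
  refine exists_forall_lt_of_forall_update _ (fun n hn c hc => ?_)
    fun n c c' hcc' h => h.congr hcc'
  have hJ := congrArg (algebraMap (MvPolynomial (Fin 2) ℂ) FF)
    (sum_jacDet_hcomp_eq_zero hdegP hdegQ hconst (n := n) (by omega))
  simp only [map_sum, jacDet, map_sub, map_mul, map_zero, ← hDx, ← hDy] at hJ
  obtain ⟨b, hb, hbq⟩ := sub_sum_powComponent_eq_C_mul_zpow hDx hDy hGF hGsimple hk hgs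
    (p := fun i => algebraMap (MvPolynomial (Fin 2) ℂ) FF (hcomp P ((k : ℤ) - (i : ℤ))))
    (q := fun i => algebraMap (MvPolynomial (Fin 2) ℂ) FF (hcomp Q ((l : ℤ) - (i : ℤ))))
    (by simp only [hcomp_natCast_sub_zero, ← hGs, map_pow])
    (euler_of_isHomogeneous hDx hDy hGhom) (euler_hcomp_natCast_sub hDx hDy P k)
    (euler_hcomp_natCast_sub hDx hDy Q l n) hJ (fun i hi => (hc i hi).1) fun i hi => (hc i hi).2
  refine ⟨b, by rwa [Function.update_self], hbq.trans ?_⟩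
  rw [Finset.sum_range_succ, Function.update_self, Nat.sub_self, powComponent_zero]
  congr 1
  refine Finset.sum_congr rfl fun r hr => ?_
  rw [Function.update_of_ne (Finset.mem_range.1 hr).ne]

/-- Under the hypotheses of the main theorem with `D(P,Q)` constant, for each
`0 ≤ j ≤ min(l-1, k+l-3)` the components `Q_{l-j'}`, `0 ≤ j' ≤ j`, are given explicitly
in terms of the homogeneous components of `P` by unique scalars `λ_0, …, λ_j ∈ ℂ`. -/
theorem components_of_Q_determined (P Q G : MvPolynomial (Fin 2) ℂ) (k l s : ℕ)
    (hP0 : eval (0 : Fin 2 → ℂ) P = 0) (hQ0 : eval (0 : Fin 2 → ℂ) Q = 0)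
    (hdegP : P.totalDegree = k) (hdegQ : Q.totalDegree = l)
    (hk : 1 ≤ k) (hl : 1 ≤ l) (hkl : 1 < k * l)
    (hconst : ∃ c : ℂ, jacDet P Q = C c)
    (hs : s = sVal (algebraMap (MvPolynomial (Fin 2) ℂ) FF (homogeneousComponent k P)))
    (hGhom : ∃ g : ℕ, G.IsHomogeneous g)
    (hGsimple : sVal (algebraMap (MvPolynomial (Fin 2) ℂ) FF G) = 1)
    (hGs : G ^ s = homogeneousComponent k P) :
    ∀ j : ℕ, j ≤ min (l - 1) (k + l - 3) →
      ∃! lam : Fin (j + 1) → ℂ,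
        (∀ r : Fin (j + 1), lam r ≠ 0 → (k : ℤ) ∣ (s : ℤ) * ((l : ℤ) - ((r : ℕ) : ℤ))) ∧
        ∀ j' : Fin (j + 1),
          algebraMap (MvPolynomial (Fin 2) ℂ) FF (hcomp Q ((l : ℤ) - ((j' : ℕ) : ℤ))) =
            ∑ r ∈ Finset.Iic j',
              ∑ᶠ a ∈ {a : ℕ+ →₀ ℕ | ssize a = (j' : ℕ) - (r : ℕ)},
                algebraMap (MvPolynomial (Fin 2) ℂ) FF (C (lam r)) *
                  ((mcoeff
                      (((if lam r = 0 then (0 : ℤ)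
                          else (s : ℤ) * ((l : ℤ) - ((r : ℕ) : ℤ)) / (k : ℤ)) : ℚ) / (s : ℚ))
                      a : ℚ) : FF) *
                  (algebraMap (MvPolynomial (Fin 2) ℂ) FF G) ^
                    ((if lam r = 0 then (0 : ℤ)
                        else (s : ℤ) * ((l : ℤ) - ((r : ℕ) : ℤ)) / (k : ℤ))
                      - (s : ℤ) * (msize a : ℤ)) *
                  algebraMap (MvPolynomial (Fin 2) ℂ) FF
                    (∏ i ∈ a.support, hcomp P ((k : ℤ) - ((i : ℕ) : ℤ)) ^ a i) := by
  intro j hj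
  obtain ⟨c₀, hc₀⟩ := hconst
  obtain ⟨g, hg⟩ := hGhom
  have hk0 : k ≠ 0 := by omega
  have hPk := homogeneousComponent_totalDegree_ne_zero hdegP hk0
  have hgs : g * s = k := (hg.pow s).inj_right
    (hGs ▸ homogeneousComponent_isHomogeneous k P) (by rwa [hGs])
  have hG0 : G ≠ 0 := by
    rintro rfl
    have hs0 : s ≠ 0 := by rintro rfl; exact hk0 (by rw [← hgs, mul_zero])
    exact hPk (by rw [← hGs, zero_pow hs0])
  have hGF : algebraMap (MvPolynomial (Fin 2) ℂ) FF G ≠ 0 := fun h => hG0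
    (IsFractionRing.injective (MvPolynomial (Fin 2) ℂ) FF (h.trans (map_zero _).symm))
  have hN : j + 1 + 2 ≤ k + l := by
    have : 3 ≤ k + l := by
      by_contra! h
      obtain ⟨rfl, rfl⟩ : k = 1 ∧ l = 1 := by omega
      omega
    have := hj.trans (min_le_right _ _)
    omega
  have hsum := fun (c : ℕ → ℂ) (hc : ∀ r : Fin (j + 1), c r ≠ 0 →
      (k : ℤ) ∣ (s : ℤ) * ((l : ℤ) - ((r : ℕ) : ℤ))) (i : Fin (j + 1)) =>
    (Finset.sum_congr rfl fun (r : Fin (j + 1)) (_ : r ∈ Finset.Iic i) =>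
      finsum_ssize_eq_C_mul_powComponent P (algebraMap _ FF G) hk0 (c r) (hc r) (i - r)).trans
      (sum_Iic_fin_eq_sum_range i fun r => algebraMap (MvPolynomial (Fin 2) ℂ) FF (C (c r)) *
        powComponent (algebraMap _ FF G) s
          (fun i => algebraMap (MvPolynomial (Fin 2) ℂ) FF (hcomp P ((k : ℤ) - (i : ℤ))))
          ((s : ℤ) * ((l : ℤ) - (r : ℤ)) / (k : ℤ)) (i - r))
  obtain ⟨c, hc⟩ := exists_isExpansionAt hdegP hdegQ hk0 hc₀ hg hG0 hgs hGsimple hGs hN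
  refine ⟨fun r => c r, ⟨fun r => (hc r r.2).1, fun i => ?_⟩, fun lam' h => ?_⟩
  · exact (hc i i.2).2.trans (hsum c (fun r => (hc r r.2).1) i).symm
  · obtain ⟨c', rfl⟩ : ∃ c' : ℕ → ℂ, lam' = fun r : Fin (j + 1) => c' r :=
      ⟨fun n => if h : n < j + 1 then lam' ⟨n, h⟩ else 0,
        funext fun r => by simp only [r.2, dite_true]⟩
    funext r
    exact IsExpansionAt.eq hGF (fun n hn => ⟨h.1 ⟨n, hn⟩, (h.2 ⟨n, hn⟩).trans
      (hsum c' h.1 ⟨n, hn⟩)⟩) hc r r.2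
end
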